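/- Let (b,Q,ν) be a Lévy triplet on ℝ^d with characteristic exponent ψ, and let A and A* be the associated Lévy generator and its adjoint. Assume: (C1) for every t > 0 there exists a function p_t : ℝ^d → [0,∞) which is continuously differentiable with p_t and ∇p_t bounded, with ∫_{ℝ^d} p_t(x) dx = 1 and ∫_{ℝ^d} e^{i ξ·x} p_t(x) dx = e^{−t ψ(ξ)} for all ξ ∈ ℝ^d; and (C2) there exists β > 0 with ∫_{|y| ≥ 1} |y|^β ν(dy) < ∞. If u : ℝ^d → ℝ is measurable, satisfies |u(x)| ≤ M(1 + |x|^γ) for all x ∈ ℝ^d for some M > 0 and some γ ∈ [0, β), and ∫_{ℝ^d} u(x) A*φ(x) dx = 0 for all φ ∈ C_c^∞(ℝ^d), then there exists a polynomial function P : ℝ^d → ℝ of total degree at most ⌊γ⌋ such that u = P Lebesgue-almost everywhere. -/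

import Mathlib

open MeasureTheory Real Filter Metric
open scoped ENNReal RealInnerProductSpace Topology

noncomputable section

/-- `ℝ^d` as a Euclidean space. -/
abbrev Ed (d : ℕ) := EuclideanSpace ℝ (Fin d)

/-- Indicator function `1_{(0,1)}(‖y‖)`. -/
def smallCut {d : ℕ} (y : Ed d) : ℝ := if 0 < ‖y‖ ∧ ‖y‖ < 1 then 1 else 0

/-- The Lévy generator associated with the triplet `(b, Q, ν)`:
`Af(x) = b·∇f(x) + (1/2) tr(Q ∇²f(x)) + ∫ (f(x+y) - f(x) - y·∇f(x) 1_{(0,1)}(|y|)) ν(dy)`. -/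
noncomputable def levyGen {d : ℕ} (b : Ed d) (Q : Matrix (Fin d) (Fin d) ℝ)
    (ν : Measure (Ed d)) (f : Ed d → ℝ) (x : Ed d) : ℝ :=
  ⟪b, gradient f x⟫
    + (1 / 2) * ∑ i, ∑ j, Q i j *
        fderiv ℝ (fun z => fderiv ℝ f z (EuclideanSpace.single j 1)) x (EuclideanSpace.single i 1)
    + ∫ y, (f (x + y) - f x - smallCut y * ⟪y, gradient f x⟫) ∂ν

/-- The characteristic exponent associated with the triplet `(b, Q, ν)`:
`ψ(ξ) = i b·ξ + (1/2) ξ·Qξ + ∫ (1 - e^{iy·ξ} + iy·ξ 1_{(0,1)}(|y|)) ν(dy)`. -/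
noncomputable def charExp {d : ℕ} (b : Ed d) (Q : Matrix (Fin d) (Fin d) ℝ)
    (ν : Measure (Ed d)) (ξ : Ed d) : ℂ :=
  Complex.I * ((⟪b, ξ⟫ : ℝ) : ℂ)
    + (1 / 2) * ((∑ i, ∑ j, ξ i * Q i j * ξ j : ℝ) : ℂ)
    + ∫ y, (1 - Complex.exp (Complex.I * ((⟪y, ξ⟫ : ℝ) : ℂ))
        + Complex.I * ((⟪y, ξ⟫ : ℝ) : ℂ) * (smallCut y : ℂ)) ∂ν

/-- `(b, Q, ν)` is a Lévy triplet on `ℝ^d`: `Q` is symmetric positive semidefinite,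
`ν({0}) = 0` and `∫ min(1,|y|²) ν(dy) < ∞`. -/
structure IsLevyTriplet {d : ℕ} (b : Ed d) (Q : Matrix (Fin d) (Fin d) ℝ)
    (ν : Measure (Ed d)) : Prop where
  posSemidef : Q.PosSemidef
  nuZero : ν {0} = 0
  nuFin : ∫⁻ y, ENNReal.ofReal (min 1 (‖y‖ ^ 2)) ∂ν ≠ ⊤

/-- `p` is a probability density whose Fourier transform is `e^{-t ψ}`, where `ψ` is the
characteristic exponent of the Lévy triplet `(b, Q, ν)`. -/
def IsTransDensity {d : ℕ} (b : Ed d) (Q : Matrix (Fin d) (Fin d) ℝ) (ν : Measure (Ed d))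
    (t : ℝ) (p : Ed d → ℝ) : Prop :=
  (∀ x, 0 ≤ p x) ∧ (∫ x, p x) = 1 ∧
    ∀ ξ : Ed d, (∫ x, Complex.exp (Complex.I * ((⟪ξ, x⟫ : ℝ) : ℂ)) * (p x : ℂ))
      = Complex.exp (-(t : ℂ) * charExp b Q ν ξ)

/-- `u` is a weak solution of `A u = 0` on `ℝ^d`, tested against the adjoint generator `A*`,
i.e. the Lévy generator with triplet `(-b, Q, ν ∘ (y ↦ -y))`. -/
def IsWeakSolZero {d : ℕ} (b : Ed d) (Q : Matrix (Fin d) (Fin d) ℝ) (ν : Measure (Ed d))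
    (u : Ed d → ℝ) : Prop :=
  ∀ φ : Ed d → ℝ, ContDiff ℝ (⊤ : ℕ∞) φ → HasCompactSupport φ →
    ∫ x, u x * levyGen (-b) Q (Measure.map Neg.neg ν) φ x = 0

section
open scoped SchwartzMap FourierTransform LineDeriv BoundedContinuousFunction Convolution
variable {d : ℕ}

/-- The integrand of the jump part of the characteristic exponent. -/
def jumpSymbol (ξ y : Ed d) : ℂ :=
  1 - Complex.exp (Complex.I * ((⟪y, ξ⟫ : ℝ) : ℂ))
    + Complex.I * ((⟪y, ξ⟫ : ℝ) : ℂ) * (smallCut y : ℂ)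

theorem measurable_smallCut : Measurable (smallCut : Ed d → ℝ) := by
  unfold smallCut
  refine Measurable.ite ?_ measurable_const measurable_const
  exact (measurableSet_lt measurable_const measurable_norm).inter
    (measurableSet_lt measurable_norm measurable_const)

theorem smallCut_neg (y : Ed d) : smallCut (-y) = smallCut y := by
  simp [smallCut]

theorem Measurable.jumpSymbol {α : Type*} [MeasurableSpace α] {f g : α → Ed d}
    (hf : Measurable f) (hg : Measurable g) : Measurable fun a => jumpSymbol (f a) (g a) := by
  unfold _root_.jumpSymbol
  have h2 : Measurable fun a => ((smallCut (g a) : ℝ) : ℂ) :=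
    Complex.measurable_ofReal.comp (measurable_smallCut.comp hg)
  have h3 : Measurable fun a => ((⟪g a, f a⟫ : ℝ) : ℂ) :=
    Complex.measurable_ofReal.comp (hg.inner hf)
  fun_prop

theorem norm_one_sub_exp_add_le (θ : ℝ) :
    ‖1 - Complex.exp (Complex.I * (θ : ℂ)) + Complex.I * (θ : ℂ)‖ ≤ 3 * θ ^ 2 := by
  rcases le_total |θ| 1 with h | h
  · have h1 : ‖Complex.I * (θ : ℂ)‖ = |θ| := by simp
    have := Complex.norm_exp_sub_one_sub_id_le (x := Complex.I * (θ : ℂ)) (by rw [h1]; exact h)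
    rw [h1, sq_abs] at this
    have h2 : 1 - Complex.exp (Complex.I * (θ : ℂ)) + Complex.I * (θ : ℂ)
        = -(Complex.exp (Complex.I * (θ : ℂ)) - 1 - Complex.I * (θ : ℂ)) := by ring
    rw [h2, norm_neg]
    nlinarith [sq_nonneg θ]
  · have h1 : ‖1 - Complex.exp (Complex.I * (θ : ℂ)) + Complex.I * (θ : ℂ)‖
        ≤ ‖(1 : ℂ)‖ + ‖Complex.exp (Complex.I * (θ : ℂ))‖ + ‖Complex.I * (θ : ℂ)‖ :=
      (norm_add_le _ _).trans (by gcongr; exact norm_sub_le _ _)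
    rw [Complex.norm_exp_I_mul_ofReal] at h1
    simp only [norm_one, norm_mul, Complex.norm_I, Complex.norm_real, Real.norm_eq_abs,
      one_mul] at h1
    rw [← sq_abs]
    nlinarith

theorem norm_jumpSymbol_le (ξ y : Ed d) :
    ‖jumpSymbol ξ y‖ ≤ 3 * (1 + ‖ξ‖ ^ 2) * min 1 (‖y‖ ^ 2) := by
  unfold jumpSymbol smallCut
  split_ifs with h
  · have h1 := norm_one_sub_exp_add_le ⟪y, ξ⟫
    have h2 : |⟪y, ξ⟫| ≤ ‖y‖ * ‖ξ‖ := abs_real_inner_le_norm y ξ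
    have h3 : ⟪y, ξ⟫ ^ 2 ≤ (‖y‖ * ‖ξ‖) ^ 2 := by rw [← sq_abs]; gcongr
    have h4 : min 1 (‖y‖ ^ 2) = ‖y‖ ^ 2 := min_eq_right (by nlinarith [h.1, h.2])
    rw [h4]
    simp only [Complex.ofReal_one, mul_one]
    nlinarith [sq_nonneg ‖y‖]
  · simp only [Complex.ofReal_zero, mul_zero, add_zero]
    by_cases hy : y = 0
    · simp [hy]
    · have h1 : 1 ≤ ‖y‖ := by
        by_contra! h'
        exact h ⟨norm_pos_iff.2 hy, h'⟩
      have h4 : min 1 (‖y‖ ^ 2) = 1 := min_eq_left (by nlinarith)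
      rw [h4]
      have h2 : ‖1 - Complex.exp (Complex.I * ((⟪y, ξ⟫ : ℝ) : ℂ))‖
          ≤ ‖(1 : ℂ)‖ + ‖Complex.exp (Complex.I * ((⟪y, ξ⟫ : ℝ) : ℂ))‖ := norm_sub_le _ _
      rw [Complex.norm_exp_I_mul_ofReal, norm_one] at h2
      nlinarith [sq_nonneg ‖ξ‖]

section Triplet

variable {b : Ed d} {Q : Matrix (Fin d) (Fin d) ℝ} {ν : Measure (Ed d)}

theorem IsLevyTriplet.integrable_min (hT : IsLevyTriplet b Q ν) :
    Integrable (fun y : Ed d => min 1 (‖y‖ ^ 2)) ν := by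
  refine ⟨(Continuous.aestronglyMeasurable (by fun_prop)), ?_⟩
  rw [hasFiniteIntegral_iff_ofReal (ae_of_all _ fun y => by positivity)]
  exact lt_top_iff_ne_top.2 hT.nuFin

theorem IsLevyTriplet.sigmaFinite (hT : IsLevyTriplet b Q ν) : SigmaFinite ν := by
  have hm : Continuous (fun y : Ed d => min 1 (‖y‖ ^ 2)) := by fun_prop
  refine ⟨⟨⟨fun n : ℕ => {0} ∪ {y : Ed d | 1 / ((n : ℝ) + 1) ≤ min 1 (‖y‖ ^ 2)},
    fun _ => trivial, fun n => ?_, ?_⟩⟩⟩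
  · refine (measure_union_le _ _).trans_lt ?_
    rw [hT.nuZero, zero_add]
    have hpos : (0 : ℝ) < 1 / ((n : ℝ) + 1) := by positivity
    refine lt_of_le_of_lt ?_ (hT.integrable_min.measure_norm_ge_lt_top hpos)
    refine measure_mono fun y hy => ?_
    simp only [Set.mem_ofPred_eq] at hy ⊢
    exact hy.trans (le_abs_self _)
  · refine Set.eq_univ_of_forall fun y => ?_
    by_cases hy : y = 0
    · exact Set.mem_iUnion.2 ⟨0, Or.inl hy⟩
    · have : 0 < min 1 (‖y‖ ^ 2) := lt_min one_pos (by have := norm_pos_iff.2 hy; positivity)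
      obtain ⟨n, hn⟩ := exists_nat_one_div_lt this
      exact Set.mem_iUnion.2 ⟨n, Or.inr hn.le⟩

theorem charExp_eq (ξ : Ed d) : charExp b Q ν ξ = Complex.I * ((⟪b, ξ⟫ : ℝ) : ℂ)
    + (1 / 2) * ((∑ i, ∑ j, ξ i * Q i j * ξ j : ℝ) : ℂ) + ∫ y, jumpSymbol ξ y ∂ν := rfl

theorem measurable_charExp (hT : IsLevyTriplet b Q ν) (b' : Ed d) :
    Measurable (charExp b' Q ν) := by
  have := hT.sigmaFinite
  have h1 : Measurable (fun ξ : Ed d => ∫ y, jumpSymbol ξ y ∂ν) :=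
    ((measurable_fst.jumpSymbol measurable_snd).stronglyMeasurable.integral_prod_right' (ν := ν)).measurable
  have h2 : Measurable (fun ξ : Ed d => Complex.I * ((⟪b', ξ⟫ : ℝ) : ℂ)
    + (1 / 2) * ((∑ i, ∑ j, ξ i * Q i j * ξ j : ℝ) : ℂ)) :=
    Continuous.measurable (by fun_prop)
  exact h2.add h1

theorem norm_charExp_le (hT : IsLevyTriplet b Q ν) (b' : Ed d) :
    ∃ C : ℝ, 0 ≤ C ∧ ∀ ξ, ‖charExp b' Q ν ξ‖ ≤ C * (1 + ‖ξ‖ ^ 2) := by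
  refine ⟨‖b'‖ + ∑ i, ∑ j, |Q i j| + ∫ y, 3 * min 1 (‖y‖ ^ 2) ∂ν, ?_, fun ξ => ?_⟩
  · have : 0 ≤ ∫ y, 3 * min 1 (‖y‖ ^ 2) ∂ν := integral_nonneg fun y => by positivity
    positivity
  rw [charExp_eq]
  have h1 : ‖Complex.I * ((⟪b', ξ⟫ : ℝ) : ℂ)‖ ≤ ‖b'‖ * (1 + ‖ξ‖ ^ 2) := by
    have : |⟪b', ξ⟫| ≤ ‖b'‖ * ‖ξ‖ := abs_real_inner_le_norm b' ξ
    have h : ‖ξ‖ ≤ 1 + ‖ξ‖ ^ 2 := by nlinarith [sq_nonneg (‖ξ‖ - 1), sq_nonneg ‖ξ‖]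
    simp only [norm_mul, Complex.norm_I, Complex.norm_real, Real.norm_eq_abs, one_mul]
    exact this.trans (by gcongr)
  have h2 : ‖(1 / 2 : ℂ) * ((∑ i, ∑ j, ξ i * Q i j * ξ j : ℝ) : ℂ)‖
      ≤ (∑ i, ∑ j, |Q i j|) * (1 + ‖ξ‖ ^ 2) := by
    rw [norm_mul, Complex.norm_real, Real.norm_eq_abs]
    have hle : |∑ i, ∑ j, ξ i * Q i j * ξ j| ≤ ∑ i, ∑ j, |Q i j| * (1 + ‖ξ‖ ^ 2) := by
      refine (Finset.abs_sum_le_sum_abs _ _).trans (Finset.sum_le_sum fun i _ => ?_)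
      refine (Finset.abs_sum_le_sum_abs _ _).trans (Finset.sum_le_sum fun j _ => ?_)
      rw [abs_mul, abs_mul]
      have hi : |ξ i| ≤ ‖ξ‖ := by simpa using PiLp.norm_apply_le ξ i
      have hj : |ξ j| ≤ ‖ξ‖ := by simpa using PiLp.norm_apply_le ξ j
      calc |ξ i| * |Q i j| * |ξ j| ≤ ‖ξ‖ * |Q i j| * ‖ξ‖ := by gcongr
        _ = |Q i j| * ‖ξ‖ ^ 2 := by ring
        _ ≤ _ := by gcongr; linarith
    simp_rw [← Finset.sum_mul] at hle
    refine le_trans ?_ hle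
    have : ‖(1 / 2 : ℂ)‖ = 1 / 2 := by norm_num
    rw [this]
    linarith [abs_nonneg (∑ i, ∑ j, ξ i * Q i j * ξ j)]
  have h3 : ‖∫ y, jumpSymbol ξ y ∂ν‖ ≤ (∫ y, 3 * min 1 (‖y‖ ^ 2) ∂ν) * (1 + ‖ξ‖ ^ 2) := by
    rw [← integral_mul_const]
    refine norm_integral_le_of_norm_le ((hT.integrable_min.const_mul 3).mul_const _)
      (ae_of_all _ fun y => (norm_jumpSymbol_le ξ y).trans (le_of_eq (by ring)))
  calc _ ≤ _ := norm_add₃_le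
    _ ≤ ‖b'‖ * (1 + ‖ξ‖ ^ 2) + (∑ i, ∑ j, |Q i j|) * (1 + ‖ξ‖ ^ 2)
        + (∫ y, 3 * min 1 (‖y‖ ^ 2) ∂ν) * (1 + ‖ξ‖ ^ 2) := by gcongr
    _ = _ := by ring

end Triplet

/-- The plane wave `exp(2πi⟨w,x⟩)`. -/
def planeWave (w x : Ed d) : ℂ := Complex.exp (Complex.I * ((⟪x, (2 * π) • w⟫ : ℝ) : ℂ))

theorem norm_planeWave (w x : Ed d) : ‖planeWave w x‖ = 1 := Complex.norm_exp_I_mul_ofReal _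

theorem continuous_planeWave_left (x : Ed d) : Continuous fun w => planeWave w x := by
  unfold planeWave; fun_prop

theorem continuous_planeWave_right (w : Ed d) : Continuous fun x => planeWave w x := by
  unfold planeWave; fun_prop

theorem planeWave_add (w x y : Ed d) : planeWave w (x + y) = planeWave w x * planeWave w y := by
  simp only [planeWave, ← Complex.exp_add, inner_add_left]
  push_cast
  ring_nf

theorem SchwartzMap.eq_integral_planeWave (f : 𝓢(Ed d, ℂ)) (x : Ed d) :
    f x = ∫ w, planeWave w x * 𝓕 f w := by
  conv_lhs => rw [← FourierTransform.fourierInv_fourier_eq (F := 𝓢(Ed d, ℂ)) f,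
    SchwartzMap.fourierInv_coe, Real.fourierInv_eq']
  refine integral_congr_ae (ae_of_all _ fun w => ?_)
  simp only [planeWave, smul_eq_mul, inner_smul_right, real_inner_comm]
  congr 2
  push_cast
  ring_nf

theorem SchwartzMap.fourier_lineDeriv_apply (f : 𝓢(Ed d, ℂ)) (m w : Ed d) :
    𝓕 (∂_{m} f) w = Complex.I * ((⟪m, (2 * π) • w⟫ : ℝ) : ℂ) * 𝓕 f w := by
  simp only [SchwartzMap.fourier_lineDerivOp_eq]
  rw [_root_.smul_apply, SchwartzMap.smulLeftCLM_apply_apply (by fun_prop)]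
  simp only [inner_smul_right, real_inner_comm m w]
  rw [Complex.real_smul]
  push_cast
  simp only [smul_eq_mul]
  ring

theorem SchwartzMap.lineDeriv_eq_integral_planeWave (f : 𝓢(Ed d, ℂ)) (m x : Ed d) :
    (∂_{m} f) x = ∫ w, planeWave w x * (Complex.I * ((⟪m, (2 * π) • w⟫ : ℝ) : ℂ) * 𝓕 f w) := by
  rw [SchwartzMap.eq_integral_planeWave]
  simp_rw [SchwartzMap.fourier_lineDeriv_apply]

theorem SchwartzMap.lineDeriv_of_real {f : 𝓢(Ed d, ℂ)} {φ : Ed d → ℝ}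
    (h : ∀ x, f x = (φ x : ℂ)) (m x : Ed d) : (∂_{m} f) x = ((fderiv ℝ φ x m : ℝ) : ℂ) := by
  have hφ : φ = fun x => Complex.reCLM (f x) := by ext x; simp [h]
  have hd : DifferentiableAt ℝ φ x := by
    rw [hφ]; exact Complex.reCLM.differentiableAt.comp x f.differentiableAt
  have h2 : (f : Ed d → ℂ) = fun x => Complex.ofRealCLM (φ x) := by ext x; simp [h]
  rw [SchwartzMap.lineDerivOp_apply_eq_fderiv, h2]
  rw [show (fun x => Complex.ofRealCLM (φ x)) = Complex.ofRealCLM ∘ φ from rfl,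
    fderiv_comp x Complex.ofRealCLM.differentiableAt hd]
  simp

theorem SchwartzMap.integrable_planeWave_mul (g : 𝓢(Ed d, ℂ)) (x : Ed d) :
    Integrable (fun w => planeWave w x * g w) := by
  have hc := continuous_planeWave_left x
  have hg : Integrable (fun w => g w) := g.integrable
  refine hg.norm.mono' (hc.mul g.continuous).aestronglyMeasurable (ae_of_all _ fun w => ?_)
  rw [norm_mul, norm_planeWave, one_mul]

theorem SchwartzMap.integrable_one_add_sq_mul (g : 𝓢(Ed d, ℂ)) :
    Integrable (fun w => (1 + ‖(2 * π) • w‖ ^ 2) * ‖g w‖) := by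
  have h := (g.integrable_pow_mul volume 0).add
    ((g.integrable_pow_mul volume 2).const_mul ((2 * π) ^ 2))
  refine h.congr (ae_of_all _ fun w => ?_)
  simp only [Pi.add_apply, norm_smul, Real.norm_eq_abs, abs_of_pos Real.two_pi_pos]
  ring

/-- The compensated increment occurring in the jump part of the generator. -/
def jumpIncrement (φ : Ed d → ℝ) (x y : Ed d) : ℝ :=
  φ (x + y) - φ x - smallCut y * ⟪y, gradient φ x⟫

theorem inner_gradient_eq (φ : Ed d → ℝ) (x y : Ed d) : ⟪y, gradient φ x⟫ = fderiv ℝ φ x y := by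
  rw [real_inner_comm, inner_gradient_left]

section
variable {b : Ed d} {Q : Matrix (Fin d) (Fin d) ℝ} {ν : Measure (Ed d)} {f : 𝓢(Ed d, ℂ)}
  {φ : Ed d → ℝ}

theorem jumpIncrement_eq_integral (h : ∀ x, f x = (φ x : ℂ)) (x y : Ed d) :
    ((jumpIncrement φ x y : ℝ) : ℂ)
      = ∫ w, planeWave w x * (-jumpSymbol ((2 * π) • w) y * 𝓕 f w) := by
  have e1 := SchwartzMap.eq_integral_planeWave f (x + y)
  have e2 := SchwartzMap.eq_integral_planeWave f x
  have e3 := SchwartzMap.lineDeriv_eq_integral_planeWave f y x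
  rw [SchwartzMap.lineDeriv_of_real h] at e3
  rw [h] at e1 e2
  have i1 := (𝓕 f).integrable_planeWave_mul (x + y)
  have i2 := (𝓕 f).integrable_planeWave_mul x
  have i3 := (𝓕 (∂_{y} f)).integrable_planeWave_mul x
  simp_rw [SchwartzMap.fourier_lineDeriv_apply] at i3
  rw [jumpIncrement, inner_gradient_eq]
  push_cast
  have i12 : Integrable fun w => planeWave w (x + y) * 𝓕 f w - planeWave w x * 𝓕 f w :=
    i1.sub i2
  rw [e1, e2, e3, ← integral_sub i1 i2, ← integral_const_mul,
    ← integral_sub i12 (i3.const_mul _)]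
  refine integral_congr_ae (ae_of_all _ fun w => ?_)
  simp only [planeWave_add, jumpSymbol]
  rw [show planeWave w y = Complex.exp (Complex.I * ((⟪y, (2 * π) • w⟫ : ℝ) : ℂ)) from rfl]
  ring

theorem integrable_planeWave_jumpSymbol (hT : IsLevyTriplet b Q ν) (x : Ed d) :
    Integrable (Function.uncurry fun y w : Ed d =>
      planeWave w x * (-jumpSymbol ((2 * π) • w) y * 𝓕 f w)) (ν.prod volume) := by
  have := hT.sigmaFinite
  have hm : Measurable (Function.uncurry fun y w : Ed d =>
      planeWave w x * (-jumpSymbol ((2 * π) • w) y * 𝓕 f w)) := by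
    have h1 : Measurable fun p : Ed d × Ed d => planeWave p.2 x :=
      (continuous_planeWave_left x).measurable.comp measurable_snd
    have h2 : Measurable fun p : Ed d × Ed d => jumpSymbol ((2 * π) • p.2) p.1 :=
      (measurable_snd.const_smul (2 * π)).jumpSymbol measurable_fst
    have h0 : Measurable fun w : Ed d => 𝓕 f w := (𝓕 f).continuous.measurable
    have h3 : Measurable fun p : Ed d × Ed d => 𝓕 f p.2 := h0.comp measurable_snd
    exact h1.mul (h2.neg.mul h3)
  have hdom : Integrable (fun p : Ed d × Ed d => (3 * min 1 (‖p.1‖ ^ 2)) *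
      ((1 + ‖(2 * π) • p.2‖ ^ 2) * ‖𝓕 f p.2‖)) (ν.prod volume) :=
    (hT.integrable_min.const_mul 3).mul_prod (SchwartzMap.integrable_one_add_sq_mul (𝓕 f))
  refine hdom.mono' hm.aestronglyMeasurable (ae_of_all _ fun p => ?_)
  simp only [Function.uncurry, norm_mul, norm_neg, norm_planeWave, one_mul]
  have := norm_jumpSymbol_le ((2 * π) • p.2) p.1
  calc _ ≤ (3 * (1 + ‖(2 * π) • p.2‖ ^ 2) * min 1 (‖p.1‖ ^ 2)) * ‖𝓕 f p.2‖ := by gcongr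
    _ = _ := by ring

theorem integral_jumpIncrement_eq (hT : IsLevyTriplet b Q ν) (h : ∀ x, f x = (φ x : ℂ))
    (x : Ed d) : ((∫ y, jumpIncrement φ x y ∂ν : ℝ) : ℂ)
      = ∫ w, planeWave w x * (-(∫ y, jumpSymbol ((2 * π) • w) y ∂ν) * 𝓕 f w) := by
  have := hT.sigmaFinite
  rw [← integral_complex_ofReal]
  simp_rw [jumpIncrement_eq_integral h]
  rw [integral_integral_swap (integrable_planeWave_jumpSymbol hT x)]
  refine integral_congr_ae (ae_of_all _ fun w => ?_)
  simp only
  rw [integral_const_mul, integral_mul_const, integral_neg]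

/-- The Lévy generator acts as a Fourier multiplier. -/
theorem levyGen_eq_integral_planeWave (hT : IsLevyTriplet b Q ν) (h : ∀ x, f x = (φ x : ℂ))
    (x : Ed d) : ((levyGen b Q ν φ x : ℝ) : ℂ)
      = ∫ w, planeWave w x * (-charExp (-b) Q ν ((2 * π) • w) * 𝓕 f w) := by
  have := hT.sigmaFinite
  have e1 : ((⟪b, gradient φ x⟫ : ℝ) : ℂ)
      = ∫ w, planeWave w x * (Complex.I * ((⟪b, (2 * π) • w⟫ : ℝ) : ℂ) * 𝓕 f w) := by
    rw [inner_gradient_eq, ← SchwartzMap.lineDeriv_of_real h,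
      SchwartzMap.lineDeriv_eq_integral_planeWave]
  have i1 := (𝓕 (∂_{b} f)).integrable_planeWave_mul x
  simp_rw [SchwartzMap.fourier_lineDeriv_apply] at i1
  have e2 : ∀ i j : Fin d, ((fderiv ℝ (fun z => fderiv ℝ φ z (EuclideanSpace.single j 1)) x
      (EuclideanSpace.single i 1) : ℝ) : ℂ) = ∫ w, planeWave w x *
        (-((((2 * π) • w) i * ((2 * π) • w) j : ℝ) : ℂ) * 𝓕 f w) := by
    intro i j
    rw [← SchwartzMap.lineDeriv_of_real (SchwartzMap.lineDeriv_of_real h _),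
      SchwartzMap.lineDeriv_eq_integral_planeWave]
    refine integral_congr_ae (ae_of_all _ fun w => ?_)
    simp only [SchwartzMap.fourier_lineDeriv_apply, EuclideanSpace.inner_single_left, map_one,
      one_mul]
    push_cast
    linear_combination (planeWave w x * (((2 * π) • w) i) * (((2 * π) • w) j) * 𝓕 f w)
      * Complex.I_mul_I
  have i2 : ∀ i j : Fin d, Integrable fun w : Ed d => planeWave w x *
        (-((((2 * π) • w) i * ((2 * π) • w) j : ℝ) : ℂ) * 𝓕 f w) := by
    intro i j
    have := (𝓕 (∂_{(EuclideanSpace.single i 1 : Ed d)}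
      (∂_{(EuclideanSpace.single j 1 : Ed d)} f))).integrable_planeWave_mul x
    refine this.congr (ae_of_all _ fun w => ?_)
    simp only [SchwartzMap.fourier_lineDeriv_apply, EuclideanSpace.inner_single_left, map_one,
      one_mul]
    push_cast
    linear_combination (planeWave w x * (((2 * π) • w) i) * (((2 * π) • w) j) * 𝓕 f w)
      * Complex.I_mul_I
  have i3 : Integrable fun w : Ed d =>
      planeWave w x * (-(∫ y, jumpSymbol ((2 * π) • w) y ∂ν) * 𝓕 f w) := by
    have := (integrable_planeWave_jumpSymbol (f := f) hT x).integral_prod_right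
    refine this.congr (ae_of_all _ fun w => ?_)
    simp only [Function.uncurry]
    rw [integral_const_mul, integral_mul_const, integral_neg]
  have i4 : Integrable fun w : Ed d => (1 / 2 : ℂ) * ∑ i, ∑ j, (Q i j : ℂ) * (planeWave w x *
        (-((((2 * π) • w) i * ((2 * π) • w) j : ℝ) : ℂ) * 𝓕 f w)) :=
    (integrable_finsetSum _ fun i _ => integrable_finsetSum _ fun j _ =>
      (i2 i j).const_mul _).const_mul _
  have e4 : (((1 / 2) * ∑ i, ∑ j, Q i j *
        fderiv ℝ (fun z => fderiv ℝ φ z (EuclideanSpace.single j 1)) x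
          (EuclideanSpace.single i 1) : ℝ) : ℂ)
      = ∫ w : Ed d, (1 / 2 : ℂ) * ∑ i, ∑ j, (Q i j : ℂ) * (planeWave w x *
        (-((((2 * π) • w) i * ((2 * π) • w) j : ℝ) : ℂ) * 𝓕 f w)) := by
    rw [integral_const_mul, integral_finsetSum _ fun i _ => integrable_finsetSum _ fun j _ =>
      (i2 i j).const_mul _]
    rw [Complex.ofReal_mul, Complex.ofReal_sum]
    congr 1
    · norm_num
    refine Finset.sum_congr rfl fun i _ => ?_
    rw [Complex.ofReal_sum, integral_finsetSum _ fun j _ => (i2 i j).const_mul _]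
    refine Finset.sum_congr rfl fun j _ => ?_
    rw [integral_const_mul, Complex.ofReal_mul, e2]
  have i14 : Integrable fun w : Ed d =>
      planeWave w x * (Complex.I * ((⟪b, (2 * π) • w⟫ : ℝ) : ℂ) * 𝓕 f w) +
      (1 / 2 : ℂ) * ∑ i, ∑ j, (Q i j : ℂ) * (planeWave w x *
        (-((((2 * π) • w) i * ((2 * π) • w) j : ℝ) : ℂ) * 𝓕 f w)) := i1.add i4
  rw [levyGen, Complex.ofReal_add, Complex.ofReal_add, e1, e4]
  rw [show (∫ y, (φ (x + y) - φ x - smallCut y * ⟪y, gradient φ x⟫) ∂ν)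
    = ∫ y, jumpIncrement φ x y ∂ν from rfl, integral_jumpIncrement_eq hT h,
    ← integral_add i1 i4, ← integral_add i14 i3]
  refine integral_congr_ae (ae_of_all _ fun w => ?_)
  simp only [charExp_eq]
  have : ∑ i, ∑ j, (Q i j : ℂ) * (planeWave w x *
        (-((((2 * π) • w) i * ((2 * π) • w) j : ℝ) : ℂ) * 𝓕 f w))
      = -planeWave w x * 𝓕 f w *
        ((∑ i, ∑ j, ((2 * π) • w) i * Q i j * ((2 * π) • w) j : ℝ) : ℂ) := by
    push_cast
    simp only [Finset.mul_sum]
    refine Finset.sum_congr rfl fun i _ => Finset.sum_congr rfl fun j _ => ?_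
    ring
  rw [this, inner_neg_left]
  push_cast
  ring

end

theorem fderiv_comp_const_sub {φ : Ed d → ℝ} (hφ : Differentiable ℝ φ) (x z v : Ed d) :
    fderiv ℝ (fun z => φ (x - z)) z v = -fderiv ℝ φ (x - z) v := by
  have h1 : HasFDerivAt (fun z : Ed d => x - z) (-ContinuousLinearMap.id ℝ (Ed d)) z :=
    (hasFDerivAt_id z).const_sub x
  have h2 := (hφ (x - z)).hasFDerivAt.comp z h1
  have h3 : fderiv ℝ (fun z => φ (x - z)) z = _ := h2.fderiv
  rw [h3]
  simp

section
variable {b : Ed d} {Q : Matrix (Fin d) (Fin d) ℝ} {ν : Measure (Ed d)} {f : 𝓢(Ed d, ℂ)}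
  {φ : Ed d → ℝ} {β : ℝ}

theorem levyGen_reflect (hφ : ContDiff ℝ (⊤ : ℕ∞) φ) (x z : Ed d) :
    levyGen (-b) Q (Measure.map Neg.neg ν) (fun z => φ (x - z)) z = levyGen b Q ν φ (x - z) := by
  have hd : Differentiable ℝ φ := hφ.differentiable (by simp)
  have hd2 : ∀ v, Differentiable ℝ fun z => fderiv ℝ φ z v := fun v =>
    ((hφ.fderiv_right (m := 1) (by norm_cast)).clm_apply contDiff_const).differentiable
      (by simp)
  unfold levyGen
  congr 1
  · congr 1
    · rw [inner_gradient_eq, inner_gradient_eq, fderiv_comp_const_sub hd]; simp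
    · congr 1
      refine Finset.sum_congr rfl fun i _ => Finset.sum_congr rfl fun j _ => ?_
      congr 1
      simp_rw [fderiv_comp_const_sub hd]
      rw [fderiv_fun_neg, _root_.neg_apply, fderiv_comp_const_sub (hd2 _), neg_neg]
  · rw [show (Measure.map Neg.neg ν) = Measure.map (MeasurableEquiv.neg (Ed d)) ν from rfl,
      (MeasurableEquiv.neg (Ed d)).measurableEmbedding.integral_map]
    refine integral_congr_ae (ae_of_all _ fun y => ?_)
    simp only [inner_gradient_eq, MeasurableEquiv.neg_apply,
      smallCut_neg, fderiv_comp_const_sub hd, map_neg]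
    rw [show x - (z + -y) = x - z + y by abel]
    simp

theorem IsWeakSolZero.integral_mul_levyGen {u : Ed d → ℝ} (hw : IsWeakSolZero b Q ν u)
    (hφ : ContDiff ℝ (⊤ : ℕ∞) φ) (hc : HasCompactSupport φ) (x : Ed d) :
    ∫ z, u z * levyGen b Q ν φ (x - z) = 0 := by
  have := hw (fun z => φ (x - z)) (hφ.comp (contDiff_const.sub contDiff_id))
    (hc.comp_homeomorph (Homeomorph.subLeft x))
  simpa only [levyGen_reflect hφ] using this

theorem integrable_charExp_mul (hT : IsLevyTriplet b Q ν) (b' : Ed d) (g : 𝓢(Ed d, ℂ)) :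
    Integrable fun w => charExp b' Q ν ((2 * π) • w) * g w := by
  obtain ⟨C, hC0, hC⟩ := norm_charExp_le hT b'
  have hm : Measurable fun w : Ed d => charExp b' Q ν ((2 * π) • w) :=
    (measurable_charExp hT b').comp (measurable_id.const_smul (2 * π))
  refine ((SchwartzMap.integrable_one_add_sq_mul g).const_mul C).mono'
    (hm.mul g.continuous.measurable).aestronglyMeasurable (ae_of_all _ fun w => ?_)
  rw [norm_mul, ← mul_assoc]
  gcongr
  exact hC _

theorem exists_schwartz_eq (hφ : ContDiff ℝ (⊤ : ℕ∞) φ) (hc : HasCompactSupport φ) :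
    ∃ f : 𝓢(Ed d, ℂ), ∀ x, f x = (φ x : ℂ) := by
  have h1 : ContDiff ℝ (⊤ : ℕ∞) fun x => ((φ x : ℝ) : ℂ) := Complex.ofRealCLM.contDiff.comp hφ
  have h2 : HasCompactSupport fun x => ((φ x : ℝ) : ℂ) := hc.comp_left (g := Complex.ofReal) rfl
  exact ⟨h2.toSchwartzMap h1, fun x => rfl⟩

theorem continuous_levyGen (hT : IsLevyTriplet b Q ν) (h : ∀ x, f x = (φ x : ℂ)) :
    Continuous (levyGen b Q ν φ) := by
  have hc : Continuous fun x =>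
      ∫ w, planeWave w x * (-charExp (-b) Q ν ((2 * π) • w) * 𝓕 f w) := by
    have hi := integrable_charExp_mul hT (-b) (𝓕 f)
    refine continuous_of_dominated (bound := fun w => ‖charExp (-b) Q ν ((2 * π) • w) * 𝓕 f w‖)
      (fun x => ?_) (fun x => ae_of_all _ fun w => ?_) hi.norm (ae_of_all _ fun w => ?_)
    · have := (continuous_planeWave_left x).aestronglyMeasurable.mul hi.neg.aestronglyMeasurable
        (μ := volume)
      refine this.congr (ae_of_all _ fun w => ?_)
      simp
    · rw [norm_mul, norm_planeWave, one_mul, norm_mul, norm_mul, norm_neg]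
    · exact (continuous_planeWave_right w).mul continuous_const
  have : levyGen b Q ν φ = fun x =>
      (∫ w, planeWave w x * (-charExp (-b) Q ν ((2 * π) • w) * 𝓕 f w)).re := by
    ext x; rw [← levyGen_eq_integral_planeWave hT h x, Complex.ofReal_re]
  rw [this]
  exact Complex.continuous_re.comp hc

/-- The jump part of the generator dominates a second difference for small jumps. -/
theorem abs_jumpIncrement_le_sq (hφ : ContDiff ℝ (⊤ : ℕ∞) φ) (hc : HasCompactSupport φ) :
    ∃ C : ℝ, 0 ≤ C ∧ ∀ x y : Ed d, |φ (x + y) - φ x - fderiv ℝ φ x y| ≤ C * ‖y‖ ^ 2 := by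
  have hd : Differentiable ℝ φ := hφ.differentiable (by simp)
  obtain ⟨C, hC⟩ := ContDiff.lipschitzWith_of_hasCompactSupport (𝕂 := ℝ)
    (hc.fderiv (𝕜 := ℝ)) (hφ.fderiv_right (m := 1) (by norm_cast)) (by simp)
  refine ⟨C, C.2, fun x y => ?_⟩
  have := (convex_closedBall x ‖y‖).norm_image_sub_le_of_norm_fderiv_le' (𝕜 := ℝ) (f := φ)
    (φ := fderiv ℝ φ x) (C := C * ‖y‖) (x := x) (y := x + y) (fun z _ => hd z) (fun z hz => ?_)
    (by simp) (by simp)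
  · rw [add_sub_cancel_left, Real.norm_eq_abs] at this
    rw [pow_two, ← mul_assoc]; exact this
  · have h1 := hC.dist_le_mul z x
    rw [dist_eq_norm] at h1
    exact h1.trans (mul_le_mul_of_nonneg_left (mem_closedBall.1 hz) C.2)

end

/-- The submultiplicative weight `(1 + ‖x‖) ^ β`. -/
def powWeight (β : ℝ) (x : Ed d) : ℝ := (1 + ‖x‖) ^ β

theorem powWeight_pos (β : ℝ) (x : Ed d) : 0 < powWeight β x := by
  unfold powWeight; positivity

theorem one_le_powWeight {β : ℝ} (hβ : 0 ≤ β) (x : Ed d) : 1 ≤ powWeight β x :=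
  Real.one_le_rpow (by simp) hβ

theorem continuous_powWeight {β : ℝ} (hβ : 0 ≤ β) : Continuous (powWeight β : Ed d → ℝ) := by
  unfold powWeight
  exact (by fun_prop : Continuous fun x : Ed d => 1 + ‖x‖).rpow_const fun _ => Or.inr hβ

theorem powWeight_add_le {β : ℝ} (hβ : 0 ≤ β) (x y : Ed d) :
    powWeight β (x + y) ≤ powWeight β x * powWeight β y := by
  unfold powWeight
  rw [← Real.mul_rpow (by positivity) (by positivity)]
  refine Real.rpow_le_rpow (by positivity) ?_ hβ
  nlinarith [norm_add_le x y, mul_nonneg (norm_nonneg x) (norm_nonneg y)]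

theorem powWeight_le_of_norm_le {β : ℝ} (hβ : 0 ≤ β) {x : Ed d} {r : ℝ} (h : ‖x‖ ≤ r) :
    powWeight β x ≤ (1 + r) ^ β :=
  Real.rpow_le_rpow (by positivity) (by linarith) hβ

theorem powWeight_neg (β : ℝ) (x : Ed d) : powWeight β (-x) = powWeight β x := by
  simp [powWeight]

section
variable {b : Ed d} {Q : Matrix (Fin d) (Fin d) ℝ} {ν : Measure (Ed d)} {f : 𝓢(Ed d, ℂ)}
  {φ : Ed d → ℝ} {β : ℝ}

theorem smallCut_eq_one {y : Ed d} (h0 : y ≠ 0) (h : ‖y‖ < 1) : smallCut y = 1 := by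
  simp [smallCut, h0, h]

theorem smallCut_eq_zero {y : Ed d} (h : 1 ≤ ‖y‖) : smallCut y = 0 := by
  simp [smallCut, h]

theorem eq_zero_of_one_lt_norm (hs : tsupport φ ⊆ closedBall 0 1) {x : Ed d} (hx : 1 < ‖x‖) :
    φ x = 0 := by
  by_contra h
  have := hs (subset_tsupport _ h)
  simp at this
  linarith

theorem fderiv_eq_zero_of_one_lt_norm (hs : tsupport φ ⊆ closedBall 0 1) {x : Ed d}
    (hx : 1 < ‖x‖) : fderiv ℝ φ x = 0 := by
  by_contra h
  have := hs (support_fderiv_subset ℝ h)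
  simp at this
  linarith

/-- The mass with which jumps of size `y` enter the weighted estimates. -/
def jumpMass (β : ℝ) (y : Ed d) : ℝ :=
  min 1 (‖y‖ ^ 2) + {y : Ed d | 1 ≤ ‖y‖}.indicator (fun y => ‖y‖ ^ β) y

theorem integrable_jumpMass (hT : IsLevyTriplet b Q ν)
    (hC2 : IntegrableOn (fun y => ‖y‖ ^ β) {y : Ed d | 1 ≤ ‖y‖} ν) :
    Integrable (jumpMass β) ν :=
  hT.integrable_min.add
    ((integrable_indicator_iff (measurableSet_le measurable_const measurable_norm)).2 hC2)

theorem abs_jumpIncrement_mul_le (hβ : 0 ≤ β) (hφ : ContDiff ℝ (⊤ : ℕ∞) φ)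
    (hs : tsupport φ ⊆ closedBall 0 1) :
    ∃ C : ℝ, ∀ x y : Ed d, |jumpIncrement φ x y * powWeight β x| ≤ C * (jumpMass β y *
      ((closedBall (0 : Ed d) 2).indicator 1 x
        + (closedBall (0 : Ed d) 1).indicator 1 (y + x))) := by
  have hc : HasCompactSupport φ := (isCompact_closedBall (0 : Ed d) 1).of_isClosed_subset
    (isClosed_tsupport φ) hs
  obtain ⟨C, hC0, hC⟩ := abs_jumpIncrement_le_sq hφ hc
  obtain ⟨B, hB⟩ := hφ.continuous.bounded_above_of_compact_support hc
  have hB0 : 0 ≤ B := (norm_nonneg _).trans (hB 0)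
  have h3 : (0 : ℝ) ≤ 3 ^ β := by positivity
  refine ⟨(C + B) * 3 ^ β, fun x y => ?_⟩
  rw [abs_mul, abs_of_pos (powWeight_pos β x)]
  rcases lt_or_ge ‖y‖ 1 with hy | hy
  · have hm : jumpMass β y = ‖y‖ ^ 2 := by
      have h1 : ‖y‖ ^ 2 ≤ 1 := by nlinarith [norm_nonneg y]
      simp [jumpMass, h1, hy]
    have hI : 0 ≤ (closedBall (0 : Ed d) 1).indicator (1 : Ed d → ℝ) (y + x) :=
      Set.indicator_nonneg (fun _ _ => zero_le_one) _
    have hle : |jumpIncrement φ x y| ≤ C * ‖y‖ ^ 2 := by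
      rcases eq_or_ne y 0 with rfl | hy0
      · simp [jumpIncrement]
      · rw [jumpIncrement, inner_gradient_eq, smallCut_eq_one hy0 hy, one_mul]
        exact hC x y
    rcases le_or_gt ‖x‖ 2 with hx | hx
    · have hw := powWeight_le_of_norm_le hβ hx
      rw [hm, Set.indicator_of_mem (by simpa using hx)]
      norm_num at hw
      calc _ ≤ (C * ‖y‖ ^ 2) * 3 ^ β := mul_le_mul hle hw (powWeight_pos β x).le (by positivity)
        _ ≤ ((C + B) * 3 ^ β) * (‖y‖ ^ 2 * 1) := by
          have : 0 ≤ B * 3 ^ β * ‖y‖ ^ 2 := by positivity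
          linarith
        _ ≤ _ := by
          gcongr
          simpa using hI
    · have e1 : φ x = 0 := eq_zero_of_one_lt_norm hs (by linarith)
      have e2 : φ (x + y) = 0 := eq_zero_of_one_lt_norm hs (by
        have := norm_sub_le (x + y) y
        rw [add_sub_cancel_right] at this; linarith)
      have e3 : fderiv ℝ φ x = 0 := fderiv_eq_zero_of_one_lt_norm hs (by linarith)
      rw [jumpIncrement, inner_gradient_eq, e1, e2, e3]
      simp only [sub_zero, _root_.zero_apply, mul_zero, abs_zero, zero_mul]
      have hJ : 0 ≤ (closedBall (0 : Ed d) 2).indicator (1 : Ed d → ℝ) x :=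
        Set.indicator_nonneg (fun _ _ => zero_le_one) _
      rw [hm]
      positivity
  · have hm : ‖y‖ ^ β ≤ jumpMass β y := by
      rw [jumpMass, Set.indicator_of_mem (by simpa using hy)]
      have : 0 ≤ min 1 (‖y‖ ^ 2) := by positivity
      linarith
    rw [jumpIncrement, smallCut_eq_zero hy, zero_mul, sub_zero]
    have h1 : |φ x| * powWeight β x ≤ (B * 3 ^ β) * (jumpMass β y *
        (closedBall (0 : Ed d) 2).indicator 1 x) := by
      rcases le_or_gt ‖x‖ 2 with hx | hx
      · have hw := powWeight_le_of_norm_le hβ hx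
        norm_num at hw
        rw [Set.indicator_of_mem (by simpa using hx)]
        have h1 : 1 ≤ jumpMass β y := (Real.one_le_rpow hy hβ).trans hm
        calc _ ≤ B * 3 ^ β := mul_le_mul (hB x) hw (powWeight_pos β x).le hB0
          _ ≤ (B * 3 ^ β) * jumpMass β y := le_mul_of_one_le_right (by positivity) h1
          _ = _ := by simp
      · rw [eq_zero_of_one_lt_norm hs (by linarith), Set.indicator_of_notMem (by simpa using hx)]
        simp
    have h2 : |φ (x + y)| * powWeight β x ≤ (B * 3 ^ β) * (jumpMass β y *
        (closedBall (0 : Ed d) 1).indicator 1 (y + x)) := by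
      rcases le_or_gt ‖y + x‖ 1 with hx | hx
      · have hx' : ‖x‖ ≤ 1 + ‖y‖ := by
          have := norm_sub_le (y + x) y
          rw [add_sub_cancel_left] at this; linarith
        have hw : powWeight β x ≤ 3 ^ β * ‖y‖ ^ β := by
          rw [← Real.mul_rpow (by norm_num) (norm_nonneg y)]
          exact Real.rpow_le_rpow (by positivity) (by linarith) hβ
        rw [Set.indicator_of_mem (by simpa using hx)]
        calc _ ≤ B * (3 ^ β * ‖y‖ ^ β) :=
              mul_le_mul (hB _) hw (powWeight_pos β x).le hB0
          _ = (B * 3 ^ β) * ‖y‖ ^ β := by ring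
          _ ≤ (B * 3 ^ β) * jumpMass β y := by gcongr
          _ = _ := by simp
      · rw [add_comm x y, eq_zero_of_one_lt_norm hs hx,
          Set.indicator_of_notMem (by simpa using hx)]
        simp
    have hJ : 0 ≤ (closedBall (0 : Ed d) 2).indicator (1 : Ed d → ℝ) x :=
        Set.indicator_nonneg (fun _ _ => zero_le_one) _
    have hI : 0 ≤ (closedBall (0 : Ed d) 1).indicator (1 : Ed d → ℝ) (y + x) :=
      Set.indicator_nonneg (fun _ _ => zero_le_one) _
    have hm0 : 0 ≤ jumpMass β y := (by positivity : 0 ≤ ‖y‖ ^ β).trans hm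
    have hC' : 0 ≤ C * 3 ^ β * (jumpMass β y * ((closedBall (0 : Ed d) 2).indicator 1 x
        + (closedBall (0 : Ed d) 1).indicator 1 (y + x))) := by positivity
    calc _ ≤ (|φ (x + y)| + |φ x|) * powWeight β x := by
          gcongr
          · exact (powWeight_pos β x).le
          · exact abs_sub _ _
      _ ≤ _ := by linarith

theorem integrable_integral_jumpIncrement_mul (hT : IsLevyTriplet b Q ν)
    (hC2 : IntegrableOn (fun y => ‖y‖ ^ β) {y : Ed d | 1 ≤ ‖y‖} ν) (hβ : 0 ≤ β)
    (hφ : ContDiff ℝ (⊤ : ℕ∞) φ) (hs : tsupport φ ⊆ closedBall 0 1) :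
    Integrable fun x => (∫ y, jumpIncrement φ x y ∂ν) * powWeight β x := by
  have := hT.sigmaFinite
  obtain ⟨C, hC⟩ := abs_jumpIncrement_mul_le hβ hφ hs
  have hind : ∀ r : ℝ, Integrable ((closedBall (0 : Ed d) r).indicator (1 : Ed d → ℝ)) := fun r =>
    (integrable_indicator_iff isClosed_closedBall.measurableSet).2
      (integrableOn_const (isCompact_closedBall _ _).measure_lt_top.ne)
  have hm := integrable_jumpMass hT hC2
  have i1 : Integrable (fun p : Ed d × Ed d => jumpMass β p.1 *
      (closedBall (0 : Ed d) 2).indicator 1 p.2) (ν.prod volume) := hm.mul_prod (hind 2)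
  have i2 : Integrable (fun p : Ed d × Ed d => jumpMass β p.1 *
      (closedBall (0 : Ed d) 1).indicator 1 (p.1 + p.2)) (ν.prod volume) :=
    (measurePreserving_prod_add ν volume).integrable_comp_of_integrable (hm.mul_prod (hind 1))
  have i3 : Integrable (fun p : Ed d × Ed d => jumpIncrement φ p.2 p.1 * powWeight β p.2)
      (ν.prod volume) := by
    refine ((i1.add i2).const_mul C).mono' ?_ (ae_of_all _ fun p => ?_)
    · have hφc := hφ.continuous
      have hd : Continuous fun p : Ed d × Ed d => fderiv ℝ φ p.2 p.1 :=
        ((hφ.continuous_fderiv (by simp)).comp continuous_snd).clm_apply continuous_fst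
      have hw := (continuous_powWeight hβ (d := d)).comp (continuous_snd (X := Ed d))
      have h1 : Continuous fun p : Ed d × Ed d => φ (p.2 + p.1) - φ p.2 := by fun_prop
      unfold jumpIncrement
      simp only [inner_gradient_eq]
      exact (((h1.measurable.sub ((measurable_smallCut.comp measurable_fst).mul
        hd.measurable)).mul hw.measurable)).aestronglyMeasurable
    · rw [Real.norm_eq_abs]
      refine (hC p.2 p.1).trans_eq ?_
      simp only [Pi.add_apply]
      ring
  refine i3.integral_prod_right.congr (ae_of_all _ fun x => ?_)
  simp only [integral_mul_const]

/-- The image of a test function under the generator decays fast enough to be paired with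
functions of growth `β`. -/
theorem integrable_levyGen_mul_powWeight (hT : IsLevyTriplet b Q ν)
    (hC2 : IntegrableOn (fun y => ‖y‖ ^ β) {y : Ed d | 1 ≤ ‖y‖} ν) (hβ : 0 ≤ β)
    (hφ : ContDiff ℝ (⊤ : ℕ∞) φ) (hs : tsupport φ ⊆ closedBall 0 1) :
    Integrable fun x => levyGen b Q ν φ x * powWeight β x := by
  have hc : HasCompactSupport φ := (isCompact_closedBall (0 : Ed d) 1).of_isClosed_subset
    (isClosed_tsupport φ) hs
  have hw := continuous_powWeight hβ (d := d)
  have k1 : ∀ v : Ed d, ContDiff ℝ (⊤ : ℕ∞) fun x => fderiv ℝ φ x v := fun v =>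
    (hφ.fderiv_right (m := (⊤ : ℕ∞)) (by norm_cast)).clm_apply contDiff_const
  have k2 : ∀ v : Ed d, HasCompactSupport fun x => fderiv ℝ φ x v := fun v =>
    hc.fderiv_apply ℝ v
  have i1 : Integrable fun x => ⟪b, gradient φ x⟫ * powWeight β x := by
    simp only [inner_gradient_eq]
    exact ((k1 b).continuous.mul hw).integrable_of_hasCompactSupport ((k2 b).mul_right)
  have i2 : Integrable fun x => ((1 / 2) * ∑ i, ∑ j, Q i j *
        fderiv ℝ (fun z => fderiv ℝ φ z (EuclideanSpace.single j 1)) x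
          (EuclideanSpace.single i 1)) * powWeight β x := by
    simp only [Finset.mul_sum, Finset.sum_mul]
    refine integrable_finsetSum _ fun i _ => integrable_finsetSum _ fun j _ => ?_
    have c1 : Continuous fun x => fderiv ℝ
        (fun z => fderiv ℝ φ z (EuclideanSpace.single j 1)) x (EuclideanSpace.single i 1) :=
      ((k1 _).continuous_fderiv (by simp)).clm_apply continuous_const
    have c2 := (k2 (EuclideanSpace.single j 1)).fderiv_apply ℝ (EuclideanSpace.single i 1)
    exact (((continuous_const.mul (continuous_const.mul c1)).mul hw)).integrable_of_hasCompactSupport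
      ((c2.mul_left).mul_left).mul_right
  have i3 := integrable_integral_jumpIncrement_mul hT hC2 hβ hφ hs
  refine ((i1.add i2).add i3).congr (ae_of_all _ fun x => ?_)
  simp only [Pi.add_apply, levyGen, jumpIncrement]
  ring

end

section
variable {b : Ed d} {Q : Matrix (Fin d) (Fin d) ℝ} {ν : Measure (Ed d)} {f : 𝓢(Ed d, ℂ)}
  {φ : Ed d → ℝ} {β : ℝ}

/-- `μ t` is, for `t ≥ 0`, a probability measure with the characteristic function of the Lévy
process generated by `levyGen b Q ν`. -/
structure IsLevyFlow (b : Ed d) (Q : Matrix (Fin d) (Fin d) ℝ) (ν : Measure (Ed d))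
    (μ : ℝ → Measure (Ed d)) : Prop where
  isProb : ∀ t, 0 ≤ t → IsProbabilityMeasure (μ t)
  charFun : ∀ t, 0 ≤ t → ∀ w, ∫ x, planeWave w x ∂μ t
    = Complex.exp (-(t : ℂ) * charExp (-b) Q ν ((2 * π) • w))

theorem charExp_neg_drift (ξ : Ed d) :
    charExp (-b) Q ν ξ = charExp b Q ν ξ - 2 * Complex.I * ((⟪b, ξ⟫ : ℝ) : ℂ) := by
  rw [charExp_eq, charExp_eq, inner_neg_left]
  push_cast
  ring

theorem exists_density {t : ℝ} {p : Ed d → ℝ} (hp : Continuous p)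
    (h : IsTransDensity b Q ν t p) :
    ∃ q : Ed d → ℝ, Continuous q ∧ (∀ x, 0 ≤ q x) ∧
      IsProbabilityMeasure (volume.withDensity fun x => ENNReal.ofReal (q x)) ∧
      ∀ w, ∫ x, planeWave w x ∂(volume.withDensity fun x => ENNReal.ofReal (q x))
        = Complex.exp (-(t : ℂ) * charExp (-b) Q ν ((2 * π) • w)) := by
  obtain ⟨h0, h1, h2⟩ := h
  have hqc : Continuous fun x => p (x - (2 * t) • b) := by fun_prop
  have hint : Integrable p := by
    by_contra hn
    rw [integral_undef hn] at h1
    exact zero_ne_one h1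
  refine ⟨fun x => p (x - (2 * t) • b), hqc, fun x => h0 _, ⟨?_⟩, fun w => ?_⟩
  · rw [withDensity_apply _ MeasurableSet.univ, Measure.restrict_univ,
      ← ofReal_integral_eq_lintegral_ofReal (hint.comp_sub_right _) (ae_of_all _ fun x => h0 _),
      integral_sub_right_eq_self p, h1, ENNReal.ofReal_one]
  · rw [integral_withDensity_eq_integral_toReal_smul hqc.measurable.ennreal_ofReal
      (ae_of_all _ fun x => ENNReal.ofReal_lt_top)]
    have e : ∀ x, (ENNReal.ofReal (p (x - (2 * t) • b))).toReal • planeWave w x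
        = (fun x => planeWave w (x + (2 * t) • b) * (p x : ℂ)) (x - (2 * t) • b) := by
      intro x
      simp only [ENNReal.toReal_ofReal (h0 _), sub_add_cancel, Complex.real_smul]
      ring
    simp_rw [e]
    rw [integral_sub_right_eq_self (fun x => planeWave w (x + (2 * t) • b) * (p x : ℂ))]
    simp_rw [planeWave_add, mul_right_comm _ (planeWave w ((2 * t) • b))]
    rw [integral_mul_const]
    have h3 := h2 ((2 * π) • w)
    simp_rw [real_inner_comm _ ((2 * π) • w)] at h3
    rw [show (∫ x, planeWave w x * (p x : ℂ)) = _ from h3, charExp_neg_drift, planeWave,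
      ← Complex.exp_add, real_inner_smul_left]
    congr 1
    push_cast
    ring

theorem exists_levyFlow (hC1 : ∀ t : ℝ, 0 < t → ∃ p : Ed d → ℝ, ContDiff ℝ 1 p ∧
      (∃ K : ℝ, ∀ x, |p x| ≤ K ∧ ‖fderiv ℝ p x‖ ≤ K) ∧ IsTransDensity b Q ν t p) :
    ∃ μ : ℝ → Measure (Ed d), IsLevyFlow b Q ν μ ∧ μ 0 = Measure.dirac 0 ∧
      ∀ t, 0 < t → ∃ q : Ed d → ℝ, Continuous q ∧ (∀ x, 0 ≤ q x) ∧
        μ t = volume.withDensity fun x => ENNReal.ofReal (q x) := by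
  have : ∀ t : ℝ, 0 < t → ∃ q : Ed d → ℝ, Continuous q ∧ (∀ x, 0 ≤ q x) ∧
      IsProbabilityMeasure (volume.withDensity fun x => ENNReal.ofReal (q x)) ∧
      ∀ w, ∫ x, planeWave w x ∂(volume.withDensity fun x => ENNReal.ofReal (q x))
        = Complex.exp (-(t : ℂ) * charExp (-b) Q ν ((2 * π) • w)) := fun t ht => by
    obtain ⟨p, hp, -, h⟩ := hC1 t ht
    exact exists_density hp.continuous h
  choose! q hq using this
  refine ⟨fun t => if 0 < t then volume.withDensity fun x => ENNReal.ofReal (q t x)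
    else Measure.dirac 0, ⟨fun t ht => ?_, fun t ht w => ?_⟩, by simp, fun t ht =>
    ⟨q t, (hq t ht).1, (hq t ht).2.1, by simp [ht]⟩⟩
  · by_cases h : 0 < t
    · simpa [h] using (hq t h).2.2.1
    · simp only [h, if_false]; infer_instance
  · by_cases h : 0 < t
    · simpa [h] using (hq t h).2.2.2 w
    · have : t = 0 := by linarith
      subst this
      simp [planeWave]

theorem continuous_planeWave_uncurry :
    Continuous fun p : Ed d × Ed d => planeWave p.1 p.2 := by
  unfold planeWave; fun_prop

theorem integral_integral_planeWave {μ : Measure (Ed d)} [IsProbabilityMeasure μ] {G : Ed d → ℂ}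
    (hG : Integrable G) :
    ∫ x, (∫ w, planeWave w x * G w) ∂μ = ∫ w, (∫ x, planeWave w x ∂μ) * G w := by
  have hi : Integrable (Function.uncurry fun x w : Ed d => planeWave w x * G w)
      (μ.prod volume) := by
    have h1 : Integrable (fun p : Ed d × Ed d => (1 : ℝ) * ‖G p.2‖) (μ.prod volume) :=
      (integrable_const (1 : ℝ)).mul_prod hG.norm
    have h2 : AEStronglyMeasurable (fun p : Ed d × Ed d => planeWave p.2 p.1)
      (μ.prod volume) :=
      (continuous_planeWave_uncurry.comp continuous_swap).aestronglyMeasurable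
    refine h1.mono' (h2.mul hG.aestronglyMeasurable.comp_snd) (ae_of_all _ fun p => ?_)
    simp only [Function.uncurry, norm_mul, norm_planeWave, le_refl]
  rw [integral_integral_swap hi]
  simp_rw [integral_mul_const]

theorem integral_planeWave_mul_integral {g : Ed d → ℝ} (hg : Integrable g) {G : Ed d → ℂ}
    (hG : Integrable G) (x : Ed d) :
    ∫ w, planeWave w x * ((∫ z, (g z : ℂ) * planeWave w (-z)) * G w)
      = ∫ z, (g z : ℂ) * ∫ w, planeWave w (x - z) * G w := by
  have hi : Integrable (Function.uncurry fun z w : Ed d =>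
      (g z : ℂ) * (planeWave w (x - z) * G w)) (volume.prod volume) := by
    have h1 : Integrable (fun p : Ed d × Ed d => (g p.1 : ℂ) * G p.2) (volume.prod volume) :=
      hg.ofReal.mul_prod hG
    have h2 : AEStronglyMeasurable (fun p : Ed d × Ed d => planeWave p.2 (x - p.1))
      (volume.prod volume) :=
      (continuous_planeWave_uncurry.comp
        (continuous_snd.prodMk (continuous_const.sub continuous_fst))).aestronglyMeasurable
    refine h1.norm.mono' (hg.ofReal.aestronglyMeasurable.comp_fst.mul
      (h2.mul hG.aestronglyMeasurable.comp_snd)) (ae_of_all _ fun p => ?_)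
    simp only [Function.uncurry, norm_mul, norm_planeWave, one_mul, le_refl]
  simp_rw [← integral_const_mul]
  rw [integral_integral_swap hi]
  refine integral_congr_ae (ae_of_all _ fun w => ?_)
  simp only [sub_eq_add_neg, planeWave_add]
  rw [← integral_mul_const, ← integral_const_mul]
  refine integral_congr_ae (ae_of_all _ fun z => ?_)
  simp only
  ring

theorem norm_exp_charExp_le {μ : ℝ → Measure (Ed d)} (hμ : IsLevyFlow b Q ν μ) {t : ℝ}
    (ht : 0 ≤ t) (w : Ed d) :
    ‖Complex.exp (-(t : ℂ) * charExp (-b) Q ν ((2 * π) • w))‖ ≤ 1 := by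
  have := hμ.isProb t ht
  rw [← hμ.charFun t ht]
  refine (norm_integral_le_integral_norm _).trans ?_
  simp [norm_planeWave]

theorem hasDerivAt_integral_exp (hT : IsLevyTriplet b Q ν) {μ : ℝ → Measure (Ed d)}
    (hμ : IsLevyFlow b Q ν μ) {G : Ed d → ℂ} (hG : Integrable G)
    (hG2 : Integrable fun w => charExp (-b) Q ν ((2 * π) • w) * G w) {t : ℝ} (ht : 0 < t) :
    HasDerivAt (fun t : ℝ => ∫ w, Complex.exp (-(t : ℂ) * charExp (-b) Q ν ((2 * π) • w)) * G w)
      (∫ w, Complex.exp (-(t : ℂ) * charExp (-b) Q ν ((2 * π) • w))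
        * -(charExp (-b) Q ν ((2 * π) • w) * G w)) t := by
  have hm : Measurable fun w : Ed d => charExp (-b) Q ν ((2 * π) • w) :=
    (measurable_charExp hT (-b)).comp (measurable_id.const_smul (2 * π))
  have he : ∀ t : ℝ, Measurable fun w : Ed d =>
      Complex.exp (-(t : ℂ) * charExp (-b) Q ν ((2 * π) • w)) := fun t =>
    Complex.measurable_exp.comp (hm.const_mul _)
  refine (hasDerivAt_integral_of_dominated_loc_of_deriv_le (s := Set.Ioi 0) (Ioi_mem_nhds ht)
    (bound := fun w => ‖charExp (-b) Q ν ((2 * π) • w) * G w‖)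
    (F' := fun (t : ℝ) w => Complex.exp (-(t : ℂ) * charExp (-b) Q ν ((2 * π) • w))
        * -(charExp (-b) Q ν ((2 * π) • w) * G w))
    (Eventually.of_forall fun s => (he s).aestronglyMeasurable.mul hG.aestronglyMeasurable)
    ?_ ?_ ?_ hG2.norm ?_).2
  · refine hG.norm.mono' ((he t).aestronglyMeasurable.mul hG.aestronglyMeasurable)
      (ae_of_all _ fun w => ?_)
    rw [Pi.mul_apply, norm_mul]
    exact mul_le_of_le_one_left (norm_nonneg _) (norm_exp_charExp_le hμ ht.le w)
  · exact (he t).aestronglyMeasurable.mul hG2.neg.aestronglyMeasurable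
  · refine ae_of_all _ fun w s hs => ?_
    rw [norm_mul, norm_neg]
    exact mul_le_of_le_one_left (norm_nonneg _) (norm_exp_charExp_le hμ (le_of_lt hs) w)
  · refine ae_of_all _ fun w s _ => ?_
    have h1 : HasDerivAt (fun s : ℝ => -(s : ℂ) * charExp (-b) Q ν ((2 * π) • w))
        (-1 * charExp (-b) Q ν ((2 * π) • w)) s :=
      (Complex.ofRealCLM.hasDerivAt.neg).mul_const _
    have h2 := h1.cexp.mul_const (G w)
    exact h2.congr_deriv (by ring)

theorem continuousOn_integral_exp (hT : IsLevyTriplet b Q ν) {μ : ℝ → Measure (Ed d)}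
    (hμ : IsLevyFlow b Q ν μ) {G : Ed d → ℂ} (hG : Integrable G) :
    ContinuousOn
      (fun t : ℝ => ∫ w, Complex.exp (-(t : ℂ) * charExp (-b) Q ν ((2 * π) • w)) * G w)
      (Set.Ici 0) := by
  have hm : Measurable fun w : Ed d => charExp (-b) Q ν ((2 * π) • w) :=
    (measurable_charExp hT (-b)).comp (measurable_id.const_smul (2 * π))
  have he : ∀ t : ℝ, Measurable fun w : Ed d =>
      Complex.exp (-(t : ℂ) * charExp (-b) Q ν ((2 * π) • w)) := fun t =>
    Complex.measurable_exp.comp (hm.const_mul _)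
  refine continuousOn_of_dominated (bound := fun w => ‖G w‖) (fun t _ =>
    (he t).aestronglyMeasurable.mul hG.aestronglyMeasurable) (fun t ht => ae_of_all _ fun w => ?_)
    hG.norm (ae_of_all _ fun w => ?_)
  · rw [norm_mul]
    exact mul_le_of_le_one_left (norm_nonneg _) (norm_exp_charExp_le hμ ht w)
  · exact Continuous.continuousOn (by fun_prop)

/-- A mean value form of Dynkin's formula for the mollification of an integrable function. -/
theorem exists_dynkin (hT : IsLevyTriplet b Q ν) {μ : ℝ → Measure (Ed d)}
    (hμ : IsLevyFlow b Q ν μ) (hφ : ContDiff ℝ (⊤ : ℕ∞) φ) (hc : HasCompactSupport φ)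
    {g : Ed d → ℝ} (hg : Integrable g) {τ : ℝ} (hτ : 0 < τ) :
    ∃ c ∈ Set.Ioo 0 τ, (∫ x, (∫ z, g z * φ (x - z)) ∂μ τ) - (∫ x, (∫ z, g z * φ (x - z)) ∂μ 0)
      = τ * ∫ x, (∫ z, g z * levyGen b Q ν φ (x - z)) ∂μ c := by
  obtain ⟨f, hf⟩ := exists_schwartz_eq hφ hc
  set gh : Ed d → ℂ := fun w => ∫ z, (g z : ℂ) * planeWave w (-z) with hgh
  have hghm : Continuous gh := by
    refine continuous_of_dominated (bound := fun z => ‖g z‖) (fun w => ?_)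
      (fun w => ae_of_all _ fun z => ?_) hg.norm (ae_of_all _ fun z => ?_)
    · exact hg.ofReal.aestronglyMeasurable.mul
        ((continuous_planeWave_right w).comp continuous_neg).aestronglyMeasurable
    · simp [norm_planeWave]
    · exact continuous_const.mul (continuous_planeWave_left _)
  have hghb : ∀ w, ‖gh w‖ ≤ ∫ z, ‖g z‖ := fun w => by
    refine (norm_integral_le_integral_norm _).trans_eq ?_
    simp [norm_planeWave]
  have hmul : ∀ {G : Ed d → ℂ}, Integrable G → Integrable fun w => gh w * G w := fun hG =>
    hG.bdd_mul hghm.aestronglyMeasurable (ae_of_all _ hghb)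
  have hf1 : Integrable fun w => 𝓕 f w := (𝓕 f).integrable
  have hf2 := integrable_charExp_mul hT (-b) (𝓕 f)
  have hG1 := hmul hf1
  have hG2 : Integrable fun w => charExp (-b) Q ν ((2 * π) • w) * (gh w * 𝓕 f w) :=
    (hmul hf2).congr (ae_of_all _ fun w => by ring)
  have e0 : ∀ t, 0 ≤ t → ((∫ x, (∫ z, g z * φ (x - z)) ∂μ t : ℝ) : ℂ)
      = ∫ w, Complex.exp (-(t : ℂ) * charExp (-b) Q ν ((2 * π) • w)) * (gh w * 𝓕 f w) := by
    intro t ht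
    have := hμ.isProb t ht
    simp_rw [← hμ.charFun t ht]
    rw [← integral_integral_planeWave hG1, ← integral_complex_ofReal]
    refine integral_congr_ae (ae_of_all _ fun x => ?_)
    simp only [hgh]
    rw [integral_planeWave_mul_integral hg hf1, ← integral_complex_ofReal]
    refine integral_congr_ae (ae_of_all _ fun z => ?_)
    simp only
    rw [← SchwartzMap.eq_integral_planeWave, hf, Complex.ofReal_mul]
  have e1 : ∀ t, 0 ≤ t → ((∫ x, (∫ z, g z * levyGen b Q ν φ (x - z)) ∂μ t : ℝ) : ℂ)
      = ∫ w, Complex.exp (-(t : ℂ) * charExp (-b) Q ν ((2 * π) • w))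
        * -(charExp (-b) Q ν ((2 * π) • w) * (gh w * 𝓕 f w)) := by
    intro t ht
    have := hμ.isProb t ht
    simp_rw [← hμ.charFun t ht]
    have hG2n : Integrable fun w => -(charExp (-b) Q ν ((2 * π) • w) * (gh w * 𝓕 f w)) := hG2.neg
    rw [← integral_integral_planeWave hG2n, ← integral_complex_ofReal]
    refine integral_congr_ae (ae_of_all _ fun x => ?_)
    have e2 : ∀ w, planeWave w x * -(charExp (-b) Q ν ((2 * π) • w) * (gh w * 𝓕 f w))
        = planeWave w x * (gh w * (-charExp (-b) Q ν ((2 * π) • w) * 𝓕 f w)) := fun w => by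
      ring
    simp_rw [e2]
    have hf3 : Integrable fun w => -charExp (-b) Q ν ((2 * π) • w) * 𝓕 f w :=
      hf2.neg.congr (ae_of_all _ fun w => by simp)
    simp only [hgh]
    rw [integral_planeWave_mul_integral hg hf3, ← integral_complex_ofReal]
    refine integral_congr_ae (ae_of_all _ fun z => ?_)
    simp only
    rw [← levyGen_eq_integral_planeWave hT hf, Complex.ofReal_mul]
  set F : ℝ → ℝ := fun t => (∫ w, Complex.exp (-(t : ℂ) * charExp (-b) Q ν ((2 * π) • w))
    * (gh w * 𝓕 f w)).re with hF
  have hFc : ContinuousOn F (Set.Icc 0 τ) :=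
    (Complex.continuous_re.comp_continuousOn (continuousOn_integral_exp hT hμ hG1)).mono
      Set.Icc_subset_Ici_self
  have hFd : ∀ t ∈ Set.Ioo 0 τ, HasDerivAt F
      (∫ x, (∫ z, g z * levyGen b Q ν φ (x - z)) ∂μ t) t := fun t ht => by
    have := Complex.reCLM.hasFDerivAt.comp_hasDerivAt t (hasDerivAt_integral_exp hT hμ hG1 hG2 ht.1)
    rw [← e1 t ht.1.le] at this
    rw [Complex.reCLM_apply, Complex.ofReal_re] at this
    exact this
  obtain ⟨c, hc, h⟩ := exists_hasDerivAt_eq_slope F _ hτ hFc hFd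
  refine ⟨c, hc, ?_⟩
  have h1 : F τ = ∫ x, (∫ z, g z * φ (x - z)) ∂μ τ := by
    rw [hF]; simp only; rw [← e0 τ hτ.le, Complex.ofReal_re]
  have h2 : F 0 = ∫ x, (∫ z, g z * φ (x - z)) ∂μ 0 := by
    rw [hF]; simp only; rw [← e0 0 le_rfl, Complex.ofReal_re]
  rw [h, h1, h2]
  rw [sub_zero, mul_div_cancel₀ _ hτ.ne']

end

/-- The pointwise convolution of `g` with the kernel `k`. -/
def kernelConv (g k : Ed d → ℝ) (x : Ed d) : ℝ := ∫ z, g z * k (x - z)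

section
variable {b : Ed d} {Q : Matrix (Fin d) (Fin d) ℝ} {ν : Measure (Ed d)}
  {φ : Ed d → ℝ} {β γ : ℝ} {k g W u : Ed d → ℝ}

theorem measurable_kernelConv (hg : Measurable g) (hk : Measurable k) :
    Measurable (kernelConv g k) := by
  have : Measurable fun p : Ed d × Ed d => g p.2 * k (p.1 - p.2) :=
    (hg.comp measurable_snd).mul (hk.comp (measurable_fst.sub measurable_snd))
  exact this.stronglyMeasurable.integral_prod_right'.measurable

/-- `W` grows at most like the weight `powWeight β` under translations. -/
def IsTemperate (β : ℝ) (W : Ed d → ℝ) : Prop :=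
  Measurable W ∧ (∀ x, 0 ≤ W x) ∧ ∀ x v, W (x - v) ≤ W x * powWeight β v

theorem powWeight_mono (h : γ ≤ β) (x : Ed d) : powWeight γ x ≤ powWeight β x :=
  Real.rpow_le_rpow_of_exponent_le (by simp) h

theorem isTemperate_powWeight (hγ : 0 ≤ γ) (h : γ ≤ β) :
    IsTemperate β (powWeight γ : Ed d → ℝ) :=
  ⟨(continuous_powWeight hγ).measurable, fun x => (powWeight_pos _ x).le, fun x v => by
    rw [sub_eq_add_neg]
    refine (powWeight_add_le hγ x (-v)).trans ?_
    rw [powWeight_neg]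
    exact mul_le_mul_of_nonneg_left (powWeight_mono h v) (powWeight_pos _ _).le⟩

theorem IsTemperate.min_const (hβ : 0 ≤ β) (hW : IsTemperate β W) {R : ℝ} (hR : 0 ≤ R) :
    IsTemperate β fun x => min (W x) R :=
  ⟨hW.1.min measurable_const, fun x => le_min (hW.2.1 x) hR, fun x v => by
    have h1 := one_le_powWeight hβ v
    have h2 := hW.2.2 x v
    simp only
    rcases min_cases (W x) R with h | h <;> rw [h.1]
    · exact (min_le_left _ _).trans h2
    · exact (min_le_right _ _).trans (le_mul_of_one_le_right hR h1)⟩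

theorem IsTemperate.const_mul (hW : IsTemperate β W) {R : ℝ} (hR : 0 ≤ R) :
    IsTemperate β fun x => R * W x :=
  ⟨hW.1.const_mul R, fun x => mul_nonneg hR (hW.2.1 x), fun x v => by
    rw [mul_assoc]; exact mul_le_mul_of_nonneg_left (hW.2.2 x v) hR⟩

theorem IsTemperate.integrable_and_le (hW : IsTemperate β W) (hkm : Measurable k)
    (hk : Integrable fun x => k x * powWeight β x) (x : Ed d) :
    (Integrable fun z => W z * |k (x - z)|) ∧
      ∫ z, W z * |k (x - z)| ≤ W x * ∫ v, |k v| * powWeight β v := by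
  have hk' : Integrable fun v => |k v| * powWeight β v := hk.norm.congr (ae_of_all _ fun v => by
    simp only [norm_mul, Real.norm_eq_abs, abs_of_pos (powWeight_pos β v)])
  have hle : ∀ v, W (x - v) * |k v| ≤ W x * (|k v| * powWeight β v) := fun v => by
    have := mul_le_mul_of_nonneg_right (hW.2.2 x v) (abs_nonneg (k v))
    linarith
  have hG : Integrable fun v => W (x - v) * |k v| := by
    refine (hk'.const_mul (W x)).mono' ((hW.1.comp (measurable_const.sub measurable_id)).mul
      hkm.abs).aestronglyMeasurable (ae_of_all _ fun v => ?_)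
    rw [Real.norm_eq_abs, abs_of_nonneg (mul_nonneg (hW.2.1 _) (abs_nonneg _))]
    exact hle v
  have e : (fun z => W z * |k (x - z)|) = fun z => (fun v => W (x - v) * |k v|) (x - z) := by
    ext z; simp
  rw [e]
  refine ⟨hG.comp_sub_left x, ?_⟩
  rw [integral_sub_left_eq_self (fun v => W (x - v) * |k v|) volume x, ← integral_const_mul]
  exact integral_mono hG (hk'.const_mul _) hle

theorem IsTemperate.integrable_mul (hW : IsTemperate β W) (hgm : Measurable g)
    (hg : ∀ x, |g x| ≤ W x) (hkm : Measurable k)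
    (hk : Integrable fun x => k x * powWeight β x) (x : Ed d) :
    Integrable fun z => g z * k (x - z) := by
  refine (hW.integrable_and_le hkm hk x).1.mono'
    (hgm.mul (hkm.comp (measurable_const.sub measurable_id))).aestronglyMeasurable
    (ae_of_all _ fun z => ?_)
  rw [norm_mul]
  exact mul_le_mul_of_nonneg_right (hg z) (abs_nonneg _)

theorem IsTemperate.abs_kernelConv_le (hW : IsTemperate β W)
    (hg : ∀ x, |g x| ≤ W x) (hkm : Measurable k)
    (hk : Integrable fun x => k x * powWeight β x) (x : Ed d) :
    |kernelConv g k x| ≤ W x * ∫ v, |k v| * powWeight β v := by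
  refine (norm_integral_le_integral_norm fun z => g z * k (x - z)).trans ?_
  refine le_trans ?_ (hW.integrable_and_le hkm hk x).2
  refine integral_mono_of_nonneg (ae_of_all _ fun z => norm_nonneg _)
    (hW.integrable_and_le hkm hk x).1 (ae_of_all _ fun z => ?_)
  simp only [norm_mul]
  exact mul_le_mul_of_nonneg_right (hg z) (abs_nonneg _)

/-- A smooth probability density supported in the unit ball. -/
structure IsMollifier (φ : Ed d → ℝ) : Prop where
  contDiff : ContDiff ℝ (⊤ : ℕ∞) φ
  tsupport_subset : tsupport φ ⊆ closedBall 0 1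
  nonneg : ∀ x, 0 ≤ φ x
  integral_eq_one : ∫ x, φ x = 1

theorem IsMollifier.hasCompactSupport (h : IsMollifier φ) : HasCompactSupport φ :=
  (isCompact_closedBall (0 : Ed d) 1).of_isClosed_subset (isClosed_tsupport φ) h.tsupport_subset

theorem IsMollifier.integrable (h : IsMollifier φ) : Integrable φ :=
  h.contDiff.continuous.integrable_of_hasCompactSupport h.hasCompactSupport

theorem IsMollifier.integrable_mul (h : IsMollifier φ) (hβ : 0 ≤ β) :
    Integrable fun x => φ x * powWeight β x :=
  (h.contDiff.continuous.mul (continuous_powWeight hβ)).integrable_of_hasCompactSupport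
    h.hasCompactSupport.mul_right

theorem IsMollifier.mul_powWeight_le (h : IsMollifier φ) (hβ : 0 ≤ β) (x : Ed d) :
    φ x * powWeight β x ≤ φ x * 2 ^ β := by
  rcases le_or_gt ‖x‖ 1 with hx | hx
  · have := powWeight_le_of_norm_le hβ hx
    norm_num at this
    exact mul_le_mul_of_nonneg_left this (h.nonneg x)
  · rw [eq_zero_of_one_lt_norm h.tsupport_subset hx]; simp

theorem IsMollifier.integral_abs_mul_le (h : IsMollifier φ) (hβ : 0 ≤ β) :
    ∫ x, |φ x| * powWeight β x ≤ 2 ^ β := by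
  simp_rw [abs_of_nonneg (h.nonneg _)]
  calc _ ≤ ∫ x, φ x * 2 ^ β := integral_mono (h.integrable_mul hβ) (h.integrable.mul_const _)
        (h.mul_powWeight_le hβ)
    _ = 2 ^ β := by rw [integral_mul_const, h.integral_eq_one, one_mul]

theorem IsMollifier.le_kernelConv (h : IsMollifier φ) (hβ : 0 ≤ β) (hW : IsTemperate β W)
    {n : ℝ} {x : Ed d} (hx : ‖x‖ + 1 ≤ n) :
    W x ≤ 2 ^ β * kernelConv ((closedBall 0 n).indicator W) φ x := by
  have hφm := h.contDiff.continuous.measurable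
  have hgm : Measurable ((closedBall (0 : Ed d) n).indicator W) :=
    hW.1.indicator isClosed_closedBall.measurableSet
  have hi := hW.integrable_mul hgm (fun z => by
    by_cases hz : z ∈ closedBall (0 : Ed d) n
    · rw [Set.indicator_of_mem hz, abs_of_nonneg (hW.2.1 z)]
    · rw [Set.indicator_of_notMem hz, abs_zero]; exact hW.2.1 z) hφm (h.integrable_mul hβ) x
  have e : W x = ∫ z, W x * φ (x - z) := by
    rw [integral_const_mul, integral_sub_left_eq_self φ volume x, h.integral_eq_one, mul_one]
  rw [e, kernelConv, ← integral_const_mul]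
  refine integral_mono ((h.integrable.comp_sub_left x).const_mul _) (hi.const_mul _) fun z => ?_
  simp only
  rcases le_or_gt ‖x - z‖ 1 with hz | hz
  · have hz' : z ∈ closedBall (0 : Ed d) n := by
      have := norm_sub_le x (x - z)
      rw [sub_sub_cancel] at this
      simp; linarith
    rw [Set.indicator_of_mem hz', ← mul_assoc]
    refine mul_le_mul_of_nonneg_right ?_ (h.nonneg _)
    have h1 := hW.2.2 z (z - x)
    rw [sub_sub_cancel, ← neg_sub, powWeight_neg] at h1
    have h2 := powWeight_le_of_norm_le hβ hz
    norm_num at h2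
    calc _ ≤ W z * powWeight β (x - z) := h1
      _ ≤ W z * 2 ^ β := mul_le_mul_of_nonneg_left h2 (hW.2.1 z)
      _ = _ := mul_comm _ _
  · rw [eq_zero_of_one_lt_norm h.tsupport_subset hz]; simp

theorem IsTemperate.integrable_indicator (hgm : Measurable g) (hW : IsTemperate β W)
    (hβ : 0 ≤ β) (hg : ∀ x, |g x| ≤ W x) (n : ℝ) :
    Integrable ((closedBall (0 : Ed d) n).indicator g) := by
  rw [integrable_indicator_iff isClosed_closedBall.measurableSet]
  refine Measure.integrableOn_of_bounded (M := W 0 * (1 + n) ^ β)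
    (isCompact_closedBall _ _).measure_lt_top.ne hgm.aestronglyMeasurable ?_
  refine (ae_restrict_iff' isClosed_closedBall.measurableSet).2 (ae_of_all _ fun x hx => ?_)
  have h1 := hW.2.2 0 (-x)
  rw [sub_neg_eq_add, zero_add, powWeight_neg] at h1
  refine (hg x).trans (h1.trans (mul_le_mul_of_nonneg_left ?_ (hW.2.1 0)))
  exact powWeight_le_of_norm_le hβ (by simpa using hx)

theorem measurable_levyGen (hT : IsLevyTriplet b Q ν) (h : IsMollifier φ) :
    Measurable (levyGen b Q ν φ) := by
  obtain ⟨f, hf⟩ := exists_schwartz_eq h.contDiff h.hasCompactSupport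
  exact (continuous_levyGen hT hf).measurable

theorem integrable_of_abs_le {μ : Measure (Ed d)} [IsFiniteMeasure μ] (hg : Measurable g) {R : ℝ}
    (h : ∀ x, |g x| ≤ R) : Integrable g μ :=
  Integrable.of_bound hg.aestronglyMeasurable R (ae_of_all _ h)

/-- One step of the bootstrap for the truncated moments. -/
theorem integral_truncated_le (hT : IsLevyTriplet b Q ν)
    (hC2 : IntegrableOn (fun y => ‖y‖ ^ β) {y : Ed d | 1 ≤ ‖y‖} ν) (hβ : 0 ≤ β)
    {μ : ℝ → Measure (Ed d)} (hμ : IsLevyFlow b Q ν μ) (hμ0 : μ 0 = Measure.dirac 0)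
    (h : IsMollifier φ) (hW : IsTemperate β W) {R : ℝ} (hWR : ∀ x, W x ≤ R) {τ S : ℝ}
    (hS : ∀ c ∈ Set.Icc 0 τ, ∫ x, W x ∂μ c ≤ S) {s : ℝ} (hs : 0 < s) (hsτ : s ≤ τ) :
    ∫ x, W x ∂μ s ≤ 2 ^ β * (W 0 * 2 ^ β
      + τ * (S * ∫ v, |levyGen b Q ν φ v| * powWeight β v)) := by
  have hφm := h.contDiff.continuous.measurable
  have hKm := measurable_levyGen hT h
  have hK := integrable_levyGen_mul_powWeight (b := b) (Q := Q) hT hC2 hβ h.contDiff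
    h.tsupport_subset
  set CK := ∫ v, |levyGen b Q ν φ v| * powWeight β v with hCK
  have hCK0 : 0 ≤ CK := integral_nonneg fun v => mul_nonneg (abs_nonneg _) (powWeight_pos _ _).le
  have hprob := hμ.isProb s hs.le
  have hR0 : 0 ≤ R := (hW.2.1 0).trans (hWR 0)
  have hbd : ∀ n : ℝ, ∀ z, |(closedBall (0 : Ed d) n).indicator W z| ≤ W z := fun n z => by
    by_cases hz : z ∈ closedBall (0 : Ed d) n
    · rw [Set.indicator_of_mem hz, abs_of_nonneg (hW.2.1 z)]
    · rw [Set.indicator_of_notMem hz, abs_zero]; exact hW.2.1 z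
  have hWabs : ∀ x, |W x| ≤ R := fun x => by rw [abs_of_nonneg (hW.2.1 x)]; exact hWR x
  have key : ∀ n : ℕ, ∫ x, (closedBall (0 : Ed d) n).indicator W x ∂μ s
      ≤ 2 ^ β * (W 0 * 2 ^ β + τ * (S * CK)) := by
    intro n
    set g := (closedBall (0 : Ed d) ((n : ℝ) + 1)).indicator W with hg
    have hgm : Measurable g := hW.1.indicator isClosed_closedBall.measurableSet
    have hgb : ∀ z, |g z| ≤ W z := hbd _
    have hgi : Integrable g := hW.integrable_indicator hW.1 hβ
      (fun x => (abs_of_nonneg (hW.2.1 x)).le) _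
    obtain ⟨c, hc, he⟩ := exists_dynkin hT hμ h.contDiff h.hasCompactSupport hgi hs
    have hcprob := hμ.isProb c hc.1.le
    rw [hμ0, integral_dirac] at he
    have hJm : Measurable (kernelConv g φ) := measurable_kernelConv hgm hφm
    have hJb : ∀ x, |kernelConv g φ x| ≤ W x * ∫ v, |φ v| * powWeight β v :=
      hW.abs_kernelConv_le hgb hφm (h.integrable_mul hβ)
    have hφ2 := h.integral_abs_mul_le hβ
    have hJi : Integrable (kernelConv g φ) (μ s) :=
      integrable_of_abs_le hJm (R := R * 2 ^ β) fun x =>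
        (hJb x).trans (mul_le_mul (hWR x) hφ2
          (integral_nonneg fun v => mul_nonneg (abs_nonneg _) (powWeight_pos _ _).le) hR0)
    have h1 : ∫ x, (closedBall (0 : Ed d) n).indicator W x ∂μ s
        ≤ 2 ^ β * ∫ x, kernelConv g φ x ∂μ s := by
      rw [← integral_const_mul]
      refine integral_mono (integrable_of_abs_le
        (hW.1.indicator isClosed_closedBall.measurableSet)
        (fun x => (hbd n x).trans (hWR x))) (hJi.const_mul _) fun x => ?_
      by_cases hx : x ∈ closedBall (0 : Ed d) n
      · rw [Set.indicator_of_mem hx]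
        exact h.le_kernelConv hβ hW (by simpa using hx)
      · rw [Set.indicator_of_notMem hx]
        refine mul_nonneg (by positivity) (integral_nonneg fun z => mul_nonneg ?_ (h.nonneg _))
        exact Set.indicator_nonneg (fun z _ => hW.2.1 z) z
    refine h1.trans (mul_le_mul_of_nonneg_left ?_ (by positivity))
    have h2 : ∫ x, kernelConv g φ x ∂μ s = kernelConv g φ 0
        + s * ∫ x, kernelConv g (levyGen b Q ν φ) x ∂μ c := by
      simp only [kernelConv]; linarith
    rw [h2]
    refine add_le_add ?_ ?_
    · exact ((le_abs_self _).trans (hJb 0)).trans (mul_le_mul_of_nonneg_left hφ2 (hW.2.1 0))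
    have h3 : ∫ x, kernelConv g (levyGen b Q ν φ) x ∂μ c ≤ S * CK := by
      calc _ ≤ ∫ x, W x * CK ∂μ c := by
            have hb : ∀ x, |kernelConv g (levyGen b Q ν φ) x| ≤ W x * CK :=
              hW.abs_kernelConv_le hgb hKm hK
            refine integral_mono (integrable_of_abs_le (measurable_kernelConv hgm hKm)
              (R := R * CK) fun x => (hb x).trans
                (mul_le_mul_of_nonneg_right (hWR x) hCK0))
              ((integrable_of_abs_le hW.1 hWabs).mul_const _) fun x => (le_abs_self _).trans (hb x)
        _ = (∫ x, W x ∂μ c) * CK := integral_mul_const _ _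
        _ ≤ S * CK := mul_le_mul_of_nonneg_right (hS c ⟨hc.1.le, hc.2.le.trans hsτ⟩) hCK0
    have hS0 : 0 ≤ S := (integral_nonneg fun x => hW.2.1 x).trans
      (hS s ⟨hs.le, hsτ⟩)
    calc _ ≤ s * (S * CK) := mul_le_mul_of_nonneg_left h3 hs.le
      _ ≤ τ * (S * CK) := mul_le_mul_of_nonneg_right hsτ (mul_nonneg hS0 hCK0)
  refine le_of_tendsto' (tendsto_integral_of_dominated_convergence (fun _ => R) (fun n =>
    (hW.1.indicator isClosed_closedBall.measurableSet).aestronglyMeasurable)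
    (integrable_const R) (fun n => ae_of_all _ fun x => (hbd n x).trans (hWR x))
    (ae_of_all _ fun x => ?_)) key
  refine tendsto_const_nhds.congr' ?_
  obtain ⟨N, hN⟩ := exists_nat_ge ‖x‖
  filter_upwards [eventually_ge_atTop N] with n hn
  rw [Set.indicator_of_mem]
  simp only [mem_closedBall, dist_zero_right]
  exact hN.trans (by exact_mod_cast hn)

/-- For small times the `β`-moments of the flow are uniformly bounded. -/
theorem exists_moment_bound (hT : IsLevyTriplet b Q ν)
    (hC2 : IntegrableOn (fun y => ‖y‖ ^ β) {y : Ed d | 1 ≤ ‖y‖} ν) (hβ : 0 ≤ β)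
    {μ : ℝ → Measure (Ed d)} (hμ : IsLevyFlow b Q ν μ) (hμ0 : μ 0 = Measure.dirac 0)
    (h : IsMollifier φ) :
    ∃ τ > 0, ∃ B : ℝ, ∀ s ∈ Set.Icc 0 τ,
      Integrable (powWeight β) (μ s) ∧ ∫ x, powWeight β x ∂μ s ≤ B := by
  set CK := ∫ v, |levyGen b Q ν φ v| * powWeight β v with hCK
  have hCK0 : 0 ≤ CK := integral_nonneg fun v => mul_nonneg (abs_nonneg _) (powWeight_pos _ _).le
  have hτ : 0 < 1 / (2 * (2 ^ β * CK + 1)) := by positivity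
  set τ := 1 / (2 * (2 ^ β * CK + 1)) with hτd
  have hτ2 : 2 ^ β * τ * CK ≤ 1 / 2 := by
    rw [hτd, div_eq_mul_inv, mul_comm (2 ^ β : ℝ), mul_assoc, one_mul, inv_mul_eq_div,
      div_le_iff₀ (by positivity)]
    linarith
  set A : ℝ := 2 ^ β * 2 ^ β
  have hA1 : 1 ≤ A := by
    have : (1 : ℝ) ≤ 2 ^ β := Real.one_le_rpow (by norm_num) hβ
    nlinarith
  have hwT : IsTemperate β (powWeight β : Ed d → ℝ) := isTemperate_powWeight hβ le_rfl
  have hw0 : powWeight β (0 : Ed d) = 1 := by simp [powWeight]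
  have key : ∀ R : ℝ, 1 ≤ R → ∀ s ∈ Set.Icc 0 τ, ∫ x, min (powWeight β x) R ∂μ s ≤ 2 * A := by
    intro R hR
    have hW := hwT.min_const hβ (R := R) (by linarith)
    set I : Set ℝ := (fun s => ∫ x, min (powWeight β x) R ∂μ s) '' Set.Icc 0 τ
    have hbdd : BddAbove I := by
      refine ⟨R, ?_⟩
      rintro _ ⟨s, hs, rfl⟩
      have := hμ.isProb s hs.1
      refine (integral_mono (integrable_of_abs_le hW.1 (R := R) fun x => ?_)
        (integrable_const R) fun x => min_le_right _ _).trans_eq (by simp)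
      rw [abs_of_nonneg (hW.2.1 x)]; exact min_le_right _ _
    have hS : ∀ c ∈ Set.Icc 0 τ, ∫ x, min (powWeight β x) R ∂μ c ≤ sSup I := fun c hc =>
      le_csSup hbdd ⟨c, hc, rfl⟩
    have hI : ∫ x, min (powWeight β x) R ∂μ 0 = 1 := by
      rw [hμ0, integral_dirac, hw0, min_eq_left hR]
    have hS1 : 1 ≤ sSup I := by rw [← hI]; exact hS 0 ⟨le_rfl, hτ.le⟩
    have hstep : sSup I ≤ A + sSup I / 2 := by
      refine csSup_le ⟨_, 0, ⟨le_rfl, hτ.le⟩, rfl⟩ ?_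
      rintro _ ⟨s, hs, rfl⟩
      rcases hs.1.eq_or_lt with rfl | hs0
      · simp only; rw [hI]; linarith
      · have := integral_truncated_le hT hC2 hβ hμ hμ0 h hW (fun x => min_le_right _ _) hS hs0 hs.2
        rw [hw0, min_eq_left hR, one_mul] at this
        refine this.trans ?_
        have h2 : 2 ^ β * τ * CK * sSup I ≤ 1 / 2 * sSup I :=
          mul_le_mul_of_nonneg_right hτ2 (by linarith)
        rw [← hCK]
        calc _ = A + 2 ^ β * τ * CK * sSup I := by ring
          _ ≤ _ := by linarith
    intro s hs
    have := hS s hs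
    linarith
  refine ⟨τ, hτ, 2 * A, fun s hs => ?_⟩
  have := hμ.isProb s hs.1
  have hlin : ∫⁻ x, ENNReal.ofReal (powWeight β x) ∂μ s ≤ ENNReal.ofReal (2 * A) := by
    have hmono : Tendsto (fun n : ℕ => ∫⁻ x, ENNReal.ofReal (min (powWeight β x) (n + 1)) ∂μ s)
        atTop (𝓝 (∫⁻ x, ENNReal.ofReal (powWeight β x) ∂μ s)) := by
      refine lintegral_tendsto_of_tendsto_of_monotone (fun n =>
        ((hwT.1.min measurable_const).ennreal_ofReal).aemeasurable)
        (ae_of_all _ fun x m n hmn => ?_) (ae_of_all _ fun x => ?_)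
      · refine ENNReal.ofReal_le_ofReal (min_le_min_left _ ?_)
        have : (m : ℝ) ≤ n := by exact_mod_cast hmn
        linarith
      · refine tendsto_const_nhds.congr' ?_
        obtain ⟨N, hN⟩ := exists_nat_ge (powWeight β x)
        filter_upwards [eventually_ge_atTop N] with n hn
        have : (N : ℝ) ≤ n := by exact_mod_cast hn
        rw [min_eq_left (by linarith)]
    refine le_of_tendsto' hmono fun n => ?_
    have hW := hwT.min_const hβ (R := (n : ℝ) + 1) (by positivity)
    rw [← ofReal_integral_eq_lintegral_ofReal
      (integrable_of_abs_le hW.1 (R := (n : ℝ) + 1) fun x => by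
        rw [abs_of_nonneg (hW.2.1 x)]; exact min_le_right _ _) (ae_of_all _ hW.2.1)]
    exact ENNReal.ofReal_le_ofReal (key _ (by simp) s hs)
  have hint : Integrable (powWeight β) (μ s) := by
    refine ⟨hwT.1.aestronglyMeasurable, ?_⟩
    rw [hasFiniteIntegral_iff_ofReal (ae_of_all _ hwT.2.1)]
    exact hlin.trans_lt ENNReal.ofReal_lt_top
  refine ⟨hint, ?_⟩
  rw [← ofReal_integral_eq_lintegral_ofReal hint (ae_of_all _ hwT.2.1)] at hlin
  exact (ENNReal.ofReal_le_ofReal_iff (by positivity)).1 hlin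

end

section
variable {b : Ed d} {Q : Matrix (Fin d) (Fin d) ℝ} {ν : Measure (Ed d)}
  {φ : Ed d → ℝ} {β γ M : ℝ} {k g W u : Ed d → ℝ}

theorem powWeight_le_mul_of_lt (hγβ : γ ≤ β) {n : ℝ} (hn : 0 ≤ n) {z : Ed d} (hz : n < ‖z‖) :
    powWeight γ z ≤ (1 + n) ^ (γ - β) * powWeight β z := by
  have h1 : powWeight γ z = powWeight (γ - β) z * powWeight β z := by
    rw [powWeight, powWeight, powWeight, ← Real.rpow_add (by positivity)]; ring_nf
  rw [h1]
  refine mul_le_mul_of_nonneg_right ?_ (powWeight_pos _ _).le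
  exact Real.rpow_le_rpow_of_nonpos (by positivity) (by linarith) (by linarith)

theorem tendsto_one_add_rpow (hγβ : γ < β) :
    Tendsto (fun n : ℕ => (1 + (n : ℝ)) ^ (γ - β)) atTop (𝓝 0) := by
  have h := tendsto_rpow_neg_atTop (y := β - γ) (by linarith)
  rw [neg_sub] at h
  exact h.comp (tendsto_atTop_add_const_left _ 1 tendsto_natCast_atTop_atTop)

theorem kernelConv_indicator_eq (h : IsMollifier φ) {n : ℝ} {x : Ed d} (hx : ‖x‖ + 1 ≤ n) :
    kernelConv ((closedBall 0 n).indicator u) φ x = kernelConv u φ x := by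
  refine integral_congr_ae (ae_of_all _ fun z => ?_)
  simp only
  rcases le_or_gt ‖x - z‖ 1 with hz | hz
  · have hz' : z ∈ closedBall (0 : Ed d) n := by
      have := norm_sub_le x (x - z)
      rw [sub_sub_cancel] at this
      simp; linarith
    rw [Set.indicator_of_mem hz']
  · rw [eq_zero_of_one_lt_norm h.tsupport_subset hz]; simp

/-- Mollified weak solutions are harmonic for the flow, at the origin. -/
theorem integral_kernelConv_eq_zero (hT : IsLevyTriplet b Q ν)
    (hC2 : IntegrableOn (fun y => ‖y‖ ^ β) {y : Ed d | 1 ≤ ‖y‖} ν) (hγ : 0 ≤ γ) (hγβ : γ < β)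
    {μ : ℝ → Measure (Ed d)} (hμ : IsLevyFlow b Q ν μ) (hμ0 : μ 0 = Measure.dirac 0)
    (h : IsMollifier φ) {τ B : ℝ} (hτ : 0 < τ) (hB : ∀ s ∈ Set.Icc 0 τ,
      Integrable (powWeight β) (μ s) ∧ ∫ x, powWeight β x ∂μ s ≤ B)
    (hu : Measurable u) (hM : 0 ≤ M) (hub : ∀ x, |u x| ≤ M * powWeight γ x)
    (hw : ∀ x, ∫ z, u z * levyGen b Q ν φ (x - z) = 0) :
    ∫ x, kernelConv u φ x ∂μ τ = kernelConv u φ 0 := by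
  have hβ : 0 ≤ β := hγ.trans hγβ.le
  have hφm := h.contDiff.continuous.measurable
  have hKm := measurable_levyGen hT h
  have hK := integrable_levyGen_mul_powWeight (b := b) (Q := Q) hT hC2 hβ h.contDiff
    h.tsupport_subset
  set CK := ∫ v, |levyGen b Q ν φ v| * powWeight β v with hCK
  have hCK0 : 0 ≤ CK := integral_nonneg fun v => mul_nonneg (abs_nonneg _) (powWeight_pos _ _).le
  have hWγ : IsTemperate β fun x : Ed d => M * powWeight γ x :=
    (isTemperate_powWeight hγ hγβ.le).const_mul hM
  set g : ℕ → Ed d → ℝ := fun n => (closedBall (0 : Ed d) n).indicator u with hg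
  have hgm : ∀ n, Measurable (g n) := fun n => hu.indicator isClosed_closedBall.measurableSet
  have hgb : ∀ n z, |g n z| ≤ M * powWeight γ z := fun n z => by
    by_cases hz : z ∈ closedBall (0 : Ed d) n
    · simp only [hg]; rw [Set.indicator_of_mem hz]; exact hub z
    · simp only [hg]; rw [Set.indicator_of_notMem hz, abs_zero]; exact hWγ.2.1 z
  have hstep : ∀ n : ℕ, ∃ c ∈ Set.Ioo 0 τ, (∫ x, kernelConv (g n) φ x ∂μ τ) - kernelConv (g n) φ 0
      = τ * ∫ x, kernelConv (g n) (levyGen b Q ν φ) x ∂μ c := fun n => by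
    obtain ⟨c, hc, he⟩ := exists_dynkin hT hμ h.contDiff h.hasCompactSupport
      (hWγ.integrable_indicator hu hβ hub n) hτ
    rw [hμ0, integral_dirac] at he
    exact ⟨c, hc, he⟩
  have htail : ∀ (n : ℕ) x, |kernelConv (g n) (levyGen b Q ν φ) x|
      ≤ M * (1 + (n : ℝ)) ^ (γ - β) * powWeight β x * CK := by
    intro n x
    have hW : IsTemperate β fun x : Ed d => M * (1 + (n : ℝ)) ^ (γ - β) * powWeight β x :=
      (isTemperate_powWeight hβ le_rfl).const_mul (by positivity)
    have e : kernelConv (g n) (levyGen b Q ν φ) x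
        = kernelConv (fun z => g n z - u z) (levyGen b Q ν φ) x := by
      simp only [kernelConv, sub_mul]
      rw [integral_sub (hWγ.integrable_mul (hgm n) (hgb n) hKm hK x)
        (hWγ.integrable_mul hu hub hKm hK x), hw, sub_zero]
    rw [e]
    refine hW.abs_kernelConv_le (fun z => ?_) hKm hK x
    by_cases hz : z ∈ closedBall (0 : Ed d) n
    · simp only [hg]; rw [Set.indicator_of_mem hz, sub_self, abs_zero]; exact hW.2.1 z
    · simp only [hg]; rw [Set.indicator_of_notMem hz, zero_sub, abs_neg]
      refine (hub z).trans ?_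
      rw [mul_assoc]
      exact mul_le_mul_of_nonneg_left (powWeight_le_mul_of_lt hγβ.le (Nat.cast_nonneg n)
        (by simpa using hz)) hM
  have hdiff : ∀ n : ℕ, |(∫ x, kernelConv (g n) φ x ∂μ τ) - kernelConv (g n) φ 0|
      ≤ (τ * (M * (B * CK))) * (1 + (n : ℝ)) ^ (γ - β) := by
    intro n
    obtain ⟨c, hc, he⟩ := hstep n
    obtain ⟨hi, hle⟩ := hB c ⟨hc.1.le, hc.2.le⟩
    rw [he, abs_mul, abs_of_pos hτ, mul_assoc]
    refine mul_le_mul_of_nonneg_left ?_ hτ.le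
    refine (norm_integral_le_integral_norm
      fun x => kernelConv (g n) (levyGen b Q ν φ) x).trans ?_
    calc _ ≤ ∫ x, M * (1 + (n : ℝ)) ^ (γ - β) * powWeight β x * CK ∂μ c :=
          integral_mono_of_nonneg (ae_of_all _ fun _ => norm_nonneg _)
            ((hi.const_mul _).mul_const _) (ae_of_all _ (htail n))
      _ = M * (1 + (n : ℝ)) ^ (γ - β) * (∫ x, powWeight β x ∂μ c) * CK := by
          rw [integral_mul_const, integral_const_mul]
      _ ≤ M * (1 + (n : ℝ)) ^ (γ - β) * B * CK := by gcongr
      _ = _ := by ring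
  have hlim1 : Tendsto (fun n => (∫ x, kernelConv (g n) φ x ∂μ τ) - kernelConv (g n) φ 0) atTop
      (𝓝 0) := by
    refine squeeze_zero_norm hdiff ?_
    simpa using (tendsto_one_add_rpow hγβ).const_mul (τ * (M * (B * CK)))
  have hpt : ∀ x, ∀ᶠ n : ℕ in atTop, kernelConv (g n) φ x = kernelConv u φ x := fun x => by
    obtain ⟨N, hN⟩ := exists_nat_ge (‖x‖ + 1)
    filter_upwards [eventually_ge_atTop N] with n hn
    exact kernelConv_indicator_eq h (hN.trans (by exact_mod_cast hn))
  have hlim2 : Tendsto (fun n => ∫ x, kernelConv (g n) φ x ∂μ τ) atTop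
      (𝓝 (∫ x, kernelConv u φ x ∂μ τ)) := by
    refine tendsto_integral_of_dominated_convergence (fun x => M * powWeight β x *
      ∫ v, |φ v| * powWeight β v) (fun n => (measurable_kernelConv (hgm n) hφm).aestronglyMeasurable)
      (((hB τ ⟨hτ.le, le_rfl⟩).1.const_mul _).mul_const _) (fun n => ae_of_all _ fun x => ?_)
      (ae_of_all _ fun x => tendsto_const_nhds.congr' ((hpt x).mono fun n hn => hn.symm))
    refine (hWγ.abs_kernelConv_le (hgb n) hφm (h.integrable_mul hβ) x).trans ?_
    refine mul_le_mul_of_nonneg_right (mul_le_mul_of_nonneg_left (powWeight_mono hγβ.le x) hM) ?_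
    exact integral_nonneg fun v => mul_nonneg (abs_nonneg _) (powWeight_pos _ _).le
  have hlim3 : Tendsto (fun n => kernelConv (g n) φ 0) atTop (𝓝 (kernelConv u φ 0)) :=
    tendsto_const_nhds.congr' ((hpt 0).mono fun n hn => hn.symm)
  have := tendsto_nhds_unique (hlim2.sub hlim3) hlim1
  linarith

theorem kernelConv_translate (g k : Ed d → ℝ) (x y : Ed d) :
    kernelConv (fun z => g (x + z)) k y = kernelConv g k (x + y) := by
  unfold kernelConv
  rw [← integral_add_left_eq_self (fun z => g z * k (x + y - z)) x]
  refine integral_congr_ae (ae_of_all _ fun z => ?_)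
  simp only [add_sub_add_left_eq_sub]

/-- Mollified weak solutions are harmonic for the flow. -/
theorem integral_kernelConv_add_eq (hT : IsLevyTriplet b Q ν)
    (hC2 : IntegrableOn (fun y => ‖y‖ ^ β) {y : Ed d | 1 ≤ ‖y‖} ν) (hγ : 0 ≤ γ) (hγβ : γ < β)
    {μ : ℝ → Measure (Ed d)} (hμ : IsLevyFlow b Q ν μ) (hμ0 : μ 0 = Measure.dirac 0)
    (h : IsMollifier φ) {τ B : ℝ} (hτ : 0 < τ) (hB : ∀ s ∈ Set.Icc 0 τ,
      Integrable (powWeight β) (μ s) ∧ ∫ x, powWeight β x ∂μ s ≤ B)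
    (hu : Measurable u) (hM : 0 ≤ M) (hub : ∀ x, |u x| ≤ M * powWeight γ x)
    (hw : ∀ x, ∫ z, u z * levyGen b Q ν φ (x - z) = 0) (x : Ed d) :
    ∫ y, kernelConv u φ (x + y) ∂μ τ = kernelConv u φ x := by
  have := integral_kernelConv_eq_zero (u := fun z => u (x + z)) (M := M * powWeight γ x) hT hC2 hγ
    hγβ hμ hμ0 h hτ hB (hu.comp (measurable_const.add measurable_id))
    (mul_nonneg hM (powWeight_pos _ _).le) (fun z => ?_) (fun y => ?_)
  · simpa only [kernelConv_translate, add_zero] using this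
  · refine (hub _).trans ?_
    rw [mul_assoc]
    exact mul_le_mul_of_nonneg_left (powWeight_add_le hγ x z) hM
  · have e := kernelConv_translate u (levyGen b Q ν φ) x y
    simp only [kernelConv] at e
    rw [e]; exact hw _

end

theorem sum_choose_mul_sq (n : ℕ) :
    ∑ i ∈ Finset.range (n + 1), (n.choose i : ℝ) * (2 * (i : ℝ) - (n : ℝ)) ^ 2 = (n : ℝ) * (2 : ℝ) ^ n := by
  have h := congrArg (Polynomial.eval (1 / 2 : ℝ)) (bernsteinPolynomial.variance ℝ n)
  simp only [Polynomial.eval_finsetSum, Polynomial.eval_mul, Polynomial.eval_pow,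
    Polynomial.eval_sub, bernsteinPolynomial, Polynomial.eval_X,
    Polynomial.eval_natCast, Polynomial.eval_one, nsmul_eq_mul] at h
  have h2 : ∑ i ∈ Finset.range (n + 1), (n.choose i : ℝ) * (2 * (i : ℝ) - n) ^ 2
      = (4 * 2 ^ n) * ∑ x ∈ Finset.range (n + 1), ((n : ℝ) * (1 / 2) - x) ^ 2 *
        ((n.choose x : ℝ) * (1 / 2) ^ x * (1 - 1 / 2) ^ (n - x)) := by
    rw [Finset.mul_sum]
    refine Finset.sum_congr rfl fun i hi => ?_
    have hi' : i ≤ n := by simpa [Nat.lt_succ_iff] using hi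
    have e : (1 / 2 : ℝ) ^ i * (1 - 1 / 2) ^ (n - i) * 2 ^ n = 1 := by
      rw [show (1 - 1 / 2 : ℝ) = 1 / 2 by norm_num, ← pow_add, Nat.add_sub_cancel' hi', ← mul_pow]
      norm_num
    linear_combination (-(n.choose i : ℝ) * (2 * (i : ℝ) - n) ^ 2) * e
  rw [h2, h]
  ring

theorem sum_choose_mul_abs_le (n : ℕ) :
    ∑ i ∈ Finset.range (n + 1), (n.choose i : ℝ) * |2 * (i : ℝ) - n| ≤ 2 ^ n * √n := by
  have h := Finset.sum_mul_sq_le_sq_mul_sq (Finset.range (n + 1))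
    (fun i => √(n.choose i : ℝ)) (fun i => √(n.choose i : ℝ) * |2 * (i : ℝ) - n|)
  have e1 : ∀ i : ℕ, √(n.choose i : ℝ) * (√(n.choose i : ℝ) * |2 * (i : ℝ) - n|)
      = (n.choose i : ℝ) * |2 * (i : ℝ) - n| := fun i => by
    rw [← mul_assoc, Real.mul_self_sqrt (by positivity)]
  have e2 : ∀ i : ℕ, (√(n.choose i : ℝ) * |2 * (i : ℝ) - n|) ^ 2
      = (n.choose i : ℝ) * (2 * (i : ℝ) - n) ^ 2 := fun i => by
    rw [mul_pow, Real.sq_sqrt (by positivity), sq_abs]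
  have e3 : ∀ i : ℕ, √(n.choose i : ℝ) ^ 2 = (n.choose i : ℝ) := fun i =>
    Real.sq_sqrt (by positivity)
  simp_rw [e1, e2, e3] at h
  rw [sum_choose_mul_sq, ← Nat.cast_sum, Nat.sum_range_choose] at h
  refine abs_le_of_sq_le_sq' ?_ (by positivity) |>.2
  refine h.trans_eq ?_
  rw [mul_pow, Real.sq_sqrt (by positivity)]
  push_cast
  ring

section
variable {A : Type*} [NormedRing A]

theorem sub_one_mul_one_add_pow (T : A) (j : ℕ) :
    (T - 1) * (1 + T) ^ j = ∑ i ∈ Finset.range (j + 2),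
      ((if i = 0 then 0 else (j.choose (i - 1) : ℤ)) - (j.choose i : ℤ)) • T ^ i := by
  have h : (1 + T) ^ j = ∑ i ∈ Finset.range (j + 1), (j.choose i : ℤ) • T ^ i := by
    rw [add_comm, (Commute.one_right T).add_pow]
    refine Finset.sum_congr rfl fun i _ => ?_
    simp only [one_pow, mul_one, natCast_zsmul, nsmul_eq_mul]
    exact ((Nat.cast_commute _ _).eq).symm
  simp only [sub_smul, Finset.sum_sub_distrib, sub_mul, one_mul]
  congr 1
  · rw [Finset.sum_range_succ', h, Finset.mul_sum]
    simp only [if_true, zero_smul, add_zero]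
    refine Finset.sum_congr rfl fun i _ => ?_
    simp only [Nat.add_eq_zero_iff, one_ne_zero, and_false, if_false, Nat.add_sub_cancel,
      natCast_zsmul, nsmul_eq_mul, pow_succ']
    rw [← mul_assoc, ← (Nat.cast_commute _ T).eq, mul_assoc]
  · rw [Finset.sum_range_succ, h]
    simp

theorem norm_zsmul_le' (n : ℤ) (a : A) : ‖n • a‖ ≤ |(n : ℝ)| * ‖a‖ := by
  have := norm_zsmul_le n a
  rwa [Int.norm_eq_abs] at this

theorem norm_sub_one_mul_one_add_pow_le (T : A) (hT : ∀ j : ℕ, ‖T ^ j‖ ≤ 1) (j : ℕ) :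
    ‖(T - 1) * (1 + T) ^ j‖ ≤ 2 * 2 ^ j / √(j + 1) := by
  rw [sub_one_mul_one_add_pow T j]
  have hc : ∀ i : ℕ, |(((if i = 0 then 0 else (j.choose (i - 1) : ℤ)) - (j.choose i : ℤ) : ℤ) : ℝ)|
      = ((j + 1).choose i : ℝ) * |2 * (i : ℝ) - (j + 1 : ℕ)| / (j + 1) := by
    intro i
    rw [eq_div_iff (by positivity), ← abs_of_pos (by positivity : (0 : ℝ) < j + 1), ← abs_mul]
    rw [← abs_of_nonneg (by positivity : (0 : ℝ) ≤ ((j + 1).choose i : ℝ)), ← abs_mul]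
    congr 1
    rcases i with _ | i
    · simp
    · have h1 := Nat.add_one_mul_choose_eq j i
      have h2 := Nat.choose_succ_succ j i
      have h1' : ((j : ℝ) + 1) * j.choose i = ((j + 1).choose (i + 1) : ℝ) * (i + 1) := by
        exact_mod_cast h1
      have h2' : ((j + 1).choose (i + 1) : ℝ) = j.choose i + j.choose (i + 1) := by
        exact_mod_cast h2
      simp only [Nat.add_eq_zero_iff, one_ne_zero, and_false, if_false, Nat.add_sub_cancel]
      push_cast
      linear_combination 2 * h1' + (j + 1) * h2'
  calc _ ≤ ∑ i ∈ Finset.range (j + 2),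
        ((j + 1).choose i : ℝ) * |2 * (i : ℝ) - (j + 1 : ℕ)| / (j + 1) := by
        refine norm_sum_le_of_le _ fun i _ => ?_
        refine (norm_zsmul_le' _ _).trans ?_
        rw [hc]
        exact mul_le_of_le_one_right (by positivity) (hT i)
    _ ≤ (2 ^ (j + 1) * √((j + 1 : ℕ) : ℝ)) / (j + 1) := by
        rw [← Finset.sum_div]
        gcongr
        exact sum_choose_mul_abs_le (j + 1)
    _ = _ := by
        have h : (0 : ℝ) < j + 1 := by positivity
        have hs : √((j : ℝ) + 1) * √((j : ℝ) + 1) = j + 1 := Real.mul_self_sqrt h.le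
        have hs0 : 0 < √((j : ℝ) + 1) := Real.sqrt_pos.2 h
        push_cast
        rw [div_eq_div_iff h.ne' hs0.ne']
        rw [mul_assoc, hs]
        ring

theorem sum_choose_div_le {q r : ℝ} (hq : 0 < q) (hr : 0 ≤ r) (h : q + r = 1) (n : ℕ) :
    ∑ j ∈ Finset.range (n + 1), q ^ j * r ^ (n - j) * (n.choose j : ℝ) / (j + 1)
      ≤ 1 / (q * (n + 1)) := by
  have e : ∑ j ∈ Finset.range (n + 1), q ^ j * r ^ (n - j) * (n.choose j : ℝ) / (j + 1)
      = (1 / (q * (n + 1))) * ∑ j ∈ Finset.range (n + 1),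
        q ^ (j + 1) * r ^ (n + 1 - (j + 1)) * ((n + 1).choose (j + 1) : ℝ) := by
    rw [Finset.mul_sum]
    refine Finset.sum_congr rfl fun j _ => ?_
    have h1 : ((n : ℝ) + 1) * n.choose j = ((n + 1).choose (j + 1) : ℝ) * (j + 1) := by
      exact_mod_cast Nat.add_one_mul_choose_eq n j
    rw [Nat.add_sub_add_right]
    field_simp
    linear_combination (q * q ^ j * r ^ (n - j)) * h1
  have h2 := add_pow q r (n + 1)
  rw [h, one_pow, Finset.sum_range_succ'] at h2
  rw [e]
  refine mul_le_of_le_one_right (by positivity) ?_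
  have : 0 ≤ q ^ 0 * r ^ (n + 1 - 0) * ((n + 1).choose 0 : ℝ) := by positivity
  linarith

/-- Quantitative asymptotic invariance: if `P = K (1 + T) + R` is a contraction splitting off
the average of two terms that differ by `T`, then `(T - 1) P ^ n` is small. -/
theorem norm_sub_one_mul_pow_le {K T R : A} {m : ℝ} (hm : 0 < m)
    (hm1 : 2 * m ≤ 1) (hKT : Commute K T) (hKR : Commute K R) (hTR : Commute T R)
    (h1 : ‖(1 : A)‖ ≤ 1) (hT : ‖T‖ ≤ 1) (hK : ‖K‖ ≤ m) (hR : ‖R‖ ≤ 1 - 2 * m) (n : ℕ) :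
    ‖(T - 1) * (K * (1 + T) + R) ^ n‖ ≤ 2 / √(2 * m * (n + 1)) := by
  have hpow : ∀ (X : A) (c : ℝ), ‖X‖ ≤ c → ∀ j : ℕ, ‖X ^ j‖ ≤ c ^ j := by
    intro X c hX j
    induction j with
    | zero => simpa using h1
    | succ j ih =>
      rw [pow_succ, pow_succ]
      exact (norm_mul_le _ _).trans (mul_le_mul ih hX (norm_nonneg _)
        ((norm_nonneg _).trans ih))
  have hTj : ∀ j : ℕ, ‖T ^ j‖ ≤ 1 := fun j => by simpa using hpow T 1 hT j
  have hK1 : Commute K (1 + T) := (Commute.one_right K).add_right hKT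
  have h1R : Commute (1 + T) R := (Commute.one_left R).add_left hTR
  have hTK : Commute (T - 1) K := (hKT.symm).sub_left (Commute.one_left K)
  have hsplit : (T - 1) * (K * (1 + T) + R) ^ n = ∑ j ∈ Finset.range (n + 1),
      (n.choose j) • (K ^ j * ((T - 1) * (1 + T) ^ j) * R ^ (n - j)) := by
    rw [(hKR.mul_left h1R).add_pow, Finset.mul_sum]
    refine Finset.sum_congr rfl fun j _ => ?_
    rw [hK1.mul_pow, nsmul_eq_mul, (Nat.cast_commute (n.choose j) _).eq]
    simp only [mul_assoc]
    rw [← mul_assoc (T - 1) (K ^ j), (hTK.pow_right j).eq]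
    simp only [mul_assoc]
  have hq : 0 < 2 * m := by positivity
  have hr : 0 ≤ 1 - 2 * m := by linarith
  set q := 2 * m with hqd
  set r := 1 - 2 * m with hrd
  have hb : ‖(T - 1) * (K * (1 + T) + R) ^ n‖ ≤ ∑ j ∈ Finset.range (n + 1),
      (q ^ j * r ^ (n - j) * (n.choose j : ℝ)) * (2 / √(j + 1)) := by
    rw [hsplit]
    refine norm_sum_le_of_le _ fun j _ => ?_
    refine (norm_nsmul_le (n := n.choose j)).trans ?_
    have e : ‖K ^ j * ((T - 1) * (1 + T) ^ j) * R ^ (n - j)‖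
        ≤ m ^ j * (2 * 2 ^ j / √(j + 1)) * r ^ (n - j) := by
      refine (norm_mul_le _ _).trans (mul_le_mul ((norm_mul_le _ _).trans (mul_le_mul
        (hpow K m hK j) (norm_sub_one_mul_one_add_pow_le T hTj j) (norm_nonneg _)
        (by positivity))) (hpow R r hR _) (norm_nonneg _) (by positivity))
    calc _ ≤ (n.choose j : ℝ) * (m ^ j * (2 * 2 ^ j / √(j + 1)) * r ^ (n - j)) := by gcongr
      _ = _ := by rw [hqd, mul_pow]; ring
  refine hb.trans ?_
  have hCS := Finset.sum_mul_sq_le_sq_mul_sq (Finset.range (n + 1))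
    (fun j : ℕ => √(q ^ j * r ^ (n - j) * (n.choose j : ℝ)))
    (fun j : ℕ => √(q ^ j * r ^ (n - j) * (n.choose j : ℝ)) * (2 / √(j + 1)))
  have hp0 : ∀ j : ℕ, 0 ≤ q ^ j * r ^ (n - j) * (n.choose j : ℝ) := fun j => by positivity
  have e1 : ∀ j : ℕ, √(q ^ j * r ^ (n - j) * (n.choose j : ℝ)) *
      (√(q ^ j * r ^ (n - j) * (n.choose j : ℝ)) * (2 / √(j + 1)))
      = (q ^ j * r ^ (n - j) * (n.choose j : ℝ)) * (2 / √(j + 1)) := fun j => by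
    rw [← mul_assoc, Real.mul_self_sqrt (hp0 j)]
  have e2 : ∀ j : ℕ, (√(q ^ j * r ^ (n - j) * (n.choose j : ℝ)) * (2 / √(j + 1))) ^ 2
      = 4 * (q ^ j * r ^ (n - j) * (n.choose j : ℝ) / (j + 1)) := fun j => by
    rw [mul_pow, Real.sq_sqrt (hp0 j), div_pow, Real.sq_sqrt (by positivity)]
    ring
  simp_rw [e1, e2, Real.sq_sqrt (hp0 _)] at hCS
  have hsum : ∑ j ∈ Finset.range (n + 1), q ^ j * r ^ (n - j) * (n.choose j : ℝ) = 1 := by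
    rw [← add_pow, show q + r = 1 by rw [hrd]; ring, one_pow]
  rw [hsum, one_mul, ← Finset.mul_sum] at hCS
  refine abs_le_of_sq_le_sq' ?_ (by positivity) |>.2
  refine hCS.trans ?_
  rw [div_pow, Real.sq_sqrt (by positivity)]
  have := sum_choose_div_le hq hr (by rw [hrd]; ring) n
  calc _ ≤ 4 * (1 / (q * (n + 1))) := by gcongr
    _ = _ := by ring

end

theorem continuous_integral_add (κ : Measure (Ed d)) [IsFiniteMeasure κ] (F : Ed d →ᵇ ℝ) :
    Continuous fun x => ∫ y, F (x + y) ∂κ := by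
  refine continuous_of_dominated (bound := fun _ => ‖F‖) (fun x => ?_)
    (fun x => ae_of_all _ fun y => F.norm_coe_le_norm _) (integrable_const _)
    (ae_of_all _ fun y => by fun_prop)
  exact Continuous.aestronglyMeasurable (by fun_prop)

theorem integrable_comp_add (κ : Measure (Ed d)) [IsFiniteMeasure κ] (F : Ed d →ᵇ ℝ) (x : Ed d) :
    Integrable (fun y => F (x + y)) κ :=
  Integrable.of_bound (C := ‖F‖) (Continuous.aestronglyMeasurable (by fun_prop))
    (ae_of_all _ fun y => F.norm_coe_le_norm _)

theorem abs_integral_comp_add_le (κ : Measure (Ed d)) [IsFiniteMeasure κ] (F : Ed d →ᵇ ℝ)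
    (x : Ed d) : ‖∫ y, F (x + y) ∂κ‖ ≤ κ.real Set.univ * ‖F‖ := by
  have := norm_integral_le_of_norm_le_const (μ := κ) (f := fun y => F (x + y)) (C := ‖F‖)
    (ae_of_all _ fun y => F.norm_coe_le_norm _)
  linarith

/-- The operator `F ↦ ∫ F(· + y) κ(dy)` on bounded continuous functions. -/
def convOp (κ : Measure (Ed d)) [IsFiniteMeasure κ] : (Ed d →ᵇ ℝ) →L[ℝ] (Ed d →ᵇ ℝ) :=
  LinearMap.mkContinuous
    { toFun := fun F => BoundedContinuousFunction.ofNormedAddCommGroup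
        (fun x => ∫ y, F (x + y) ∂κ) (continuous_integral_add κ F) (κ.real Set.univ * ‖F‖)
        (abs_integral_comp_add_le κ F)
      map_add' := fun F G => by
        ext x
        exact integral_add (integrable_comp_add κ F x) (integrable_comp_add κ G x)
      map_smul' := fun c F => by
        ext x
        exact integral_const_mul c _ }
    (κ.real Set.univ) fun F => BoundedContinuousFunction.norm_ofNormedAddCommGroup_le _
      (by positivity) (abs_integral_comp_add_le κ F)

section
variable (κ ρ : Measure (Ed d)) [IsFiniteMeasure κ] [IsFiniteMeasure ρ]

theorem convOp_apply (F : Ed d →ᵇ ℝ) (x : Ed d) : convOp κ F x = ∫ y, F (x + y) ∂κ := rfl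

theorem norm_convOp_le : ‖convOp κ‖ ≤ κ.real Set.univ :=
  LinearMap.mkContinuous_norm_le _ (by positivity) _

theorem convOp_add : convOp (κ + ρ) = convOp κ + convOp ρ := by
  ext F x
  exact integral_add_measure (integrable_comp_add κ F x) (integrable_comp_add ρ F x)

theorem commute_convOp : Commute (convOp κ) (convOp ρ) := by
  ext F x
  change ∫ y, (∫ z, F (x + y + z) ∂ρ) ∂κ = ∫ y, (∫ z, F (x + y + z) ∂κ) ∂ρ
  rw [integral_integral_swap]
  · simp_rw [add_right_comm x]
  · refine Integrable.of_bound (C := ‖F‖) ?_ (ae_of_all _ fun y => F.norm_coe_le_norm _)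
    exact Continuous.aestronglyMeasurable (by unfold Function.uncurry; fun_prop)

theorem convOp_dirac_apply (h : Ed d) (F : Ed d →ᵇ ℝ) (x : Ed d) :
    convOp (Measure.dirac h) F x = F (x + h) := by
  rw [convOp_apply, integral_dirac]

theorem convOp_map_add_right (h : Ed d) :
    convOp (κ.map (· + h)) = convOp κ * convOp (Measure.dirac h) := by
  ext F x
  rw [mul_apply_eq_comp, convOp_apply, convOp_apply]
  simp_rw [convOp_dirac_apply]
  rw [integral_map (by fun_prop) (Continuous.aestronglyMeasurable (by fun_prop))]
  simp_rw [add_assoc]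

end

theorem exists_ball_le_withDensity {q : Ed d → ℝ} (hq : Continuous q)
    {μ : Measure (Ed d)} [IsProbabilityMeasure μ]
    (hμ : μ = volume.withDensity fun x => ENNReal.ofReal (q x)) :
    ∃ (x₀ : Ed d) (c r : ℝ), 0 < c ∧ 0 < r ∧
      ENNReal.ofReal c • volume.restrict (ball x₀ (2 * r)) ≤ μ := by
  obtain ⟨x₀, hx₀⟩ : ∃ x, 0 < q x := by
    by_contra! h
    have h0 : ∀ x, ENNReal.ofReal (q x) = 0 := fun x => ENNReal.ofReal_eq_zero.2 (h x)
    simp_rw [h0] at hμ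
    have := measure_univ (μ := μ)
    rw [hμ] at this
    simp at this
  have h1 : ∀ᶠ x in 𝓝 x₀, q x₀ / 2 < q x :=
    hq.continuousAt.eventually (lt_mem_nhds (by linarith))
  obtain ⟨R, hR, hb⟩ := Metric.eventually_nhds_iff_ball.1 h1
  refine ⟨x₀, q x₀ / 2, R / 2, by positivity, by positivity, ?_⟩
  refine Measure.le_iff.2 fun s hs => ?_
  rw [mul_div_cancel₀ _ two_ne_zero, hμ, withDensity_apply _ hs, Measure.smul_apply,
    Measure.restrict_apply hs, smul_eq_mul, ← setLIntegral_const]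
  calc _ ≤ ∫⁻ x in s ∩ ball x₀ R, ENNReal.ofReal (q x) :=
        setLIntegral_mono' (hs.inter measurableSet_ball) fun x hx =>
          ENNReal.ofReal_le_ofReal (hb x hx.2).le
    _ ≤ _ := lintegral_mono_set Set.inter_subset_left

/-- A probability measure with continuous density splits off, uniformly for small `h`, a
measure of the form `κ + κ(· - h)`. -/
theorem exists_norm_convOp_pow_le {q : Ed d → ℝ} (hq : Continuous q)
    {μ : Measure (Ed d)} [IsProbabilityMeasure μ]
    (hμ : μ = volume.withDensity fun x => ENNReal.ofReal (q x)) :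
    ∃ r > 0, ∃ m : ℝ, 0 < m ∧ ∀ h : Ed d, ‖h‖ < r → ∀ n : ℕ,
      ‖(convOp (Measure.dirac h) - 1) * convOp μ ^ n‖ ≤ 2 / √(2 * m * (n + 1)) := by
  obtain ⟨x₀, c, r, hc, hr, hle⟩ := exists_ball_le_withDensity hq hμ
  set κ : Measure (Ed d) := ENNReal.ofReal (c / 2) • volume.restrict (ball x₀ r) with hκ
  have hfin : IsFiniteMeasure (volume.restrict (ball x₀ r)) :=
    ⟨by simpa using measure_ball_lt_top⟩
  have hκf : IsFiniteMeasure κ := Measure.smul_finite _ ENNReal.ofReal_ne_top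
  have hm : 0 < κ.real Set.univ := by
    rw [measureReal_def]
    refine ENNReal.toReal_pos ?_ (measure_ne_top _ _)
    simp only [hκ, Measure.smul_apply, smul_eq_mul, Measure.restrict_apply_univ]
    refine mul_ne_zero ?_ (measure_ball_pos _ _ hr).ne'
    simpa using hc
  refine ⟨r, hr, κ.real Set.univ, hm, fun h hh n => ?_⟩
  have hadd : κ + κ.map (· + h) ≤ μ := by
    refine le_trans ?_ hle
    have hmap : κ.map (· + h) = ENNReal.ofReal (c / 2) • volume.restrict (ball (x₀ + h) r) := by
      rw [hκ, Measure.map_smul]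
      congr 1
      have := (measurePreserving_add_right (volume : Measure (Ed d)) h).restrict_preimage
        (s := ball (x₀ + h) r) measurableSet_ball
      rw [← this.map_eq]
      congr 2
      ext y
      simp [dist_eq_norm]
    rw [hmap, hκ, ← smul_add]
    have hh' : ENNReal.ofReal c = ENNReal.ofReal (c / 2) * 2 := by
      rw [← ENNReal.ofReal_ofNat, ← ENNReal.ofReal_mul (by positivity)]
      congr 1; ring
    rw [hh', mul_smul]
    have hsmul : ∀ η₁ η₂ : Measure (Ed d), η₁ ≤ η₂ →
        ENNReal.ofReal (c / 2) • η₁ ≤ ENNReal.ofReal (c / 2) • η₂ := fun η₁ η₂ h => by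
      refine Measure.le_iff.2 fun s _ => ?_
      simp only [Measure.smul_apply, smul_eq_mul]
      exact mul_le_mul_right (h s) _
    refine hsmul _ _ ?_
    rw [two_smul]
    refine add_le_add (Measure.restrict_mono (ball_subset_ball (by linarith)) le_rfl)
      (Measure.restrict_mono ?_ le_rfl)
    intro y hy
    rw [mem_ball, dist_eq_norm] at hy ⊢
    calc ‖y - x₀‖ = ‖(y - (x₀ + h)) + h‖ := by congr 1; abel
      _ ≤ ‖y - (x₀ + h)‖ + ‖h‖ := norm_add_le _ _
      _ < 2 * r := by linarith
  have hmapf : IsFiniteMeasure (κ.map (· + h)) := inferInstance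
  have hμeq : μ = (κ + κ.map (· + h)) + (μ - (κ + κ.map (· + h))) := by
    rw [add_comm, Measure.sub_add_cancel_of_le hadd]
  set ρ := μ - (κ + κ.map (· + h)) with hρ
  have hρf : IsFiniteMeasure ρ := isFiniteMeasure_of_le μ Measure.sub_le
  have hmass : ρ.real Set.univ = 1 - 2 * κ.real Set.univ := by
    have e := congrArg (fun η : Measure (Ed d) => η.real Set.univ) hμeq
    beta_reduce at e
    rw [measureReal_add_apply, measureReal_add_apply, probReal_univ, map_measureReal_apply (by fun_prop) MeasurableSet.univ,
      Set.preimage_univ] at e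
    linarith
  have hop : convOp μ = convOp κ * (1 + convOp (Measure.dirac h)) + convOp ρ := by
    have : convOp μ = convOp ((κ + κ.map (· + h)) + ρ) := by congr 1
    rw [this, convOp_add, convOp_add, convOp_map_add_right, mul_add, mul_one]
  rw [hop]
  refine norm_sub_one_mul_pow_le (A := (Ed d →ᵇ ℝ) →L[ℝ] (Ed d →ᵇ ℝ)) hm ?_
    (commute_convOp _ _) (commute_convOp _ _) (commute_convOp _ _)
    ContinuousLinearMap.norm_id_le ?_ (norm_convOp_le κ) ?_ n
  · have : 0 ≤ ρ.real Set.univ := by positivity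
    linarith
  · simpa using norm_convOp_le (Measure.dirac h)
  · exact hmass ▸ norm_convOp_le ρ

/-- The iterated difference of `F` with steps taken from the list `l`. -/
def mixedDiff (l : List (Ed d)) (F : Ed d → ℝ) : Ed d → ℝ :=
  l.foldr (fun h G x => G (x + h) - G x) F

theorem mixedDiff_cons (h : Ed d) (l : List (Ed d)) (F : Ed d → ℝ) (x : Ed d) :
    mixedDiff (h :: l) F x = mixedDiff l F (x + h) - mixedDiff l F x := rfl

theorem mixedDiff_add (l : List (Ed d)) (F G : Ed d → ℝ) :
    mixedDiff l (F + G) = mixedDiff l F + mixedDiff l G := by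
  induction l with
  | nil => rfl
  | cons h l ih =>
    ext x
    simp only [mixedDiff_cons, ih, Pi.add_apply]
    ring

theorem abs_mixedDiff_le {β : ℝ} (hβ : 0 ≤ β) {G : Ed d → ℝ} {c r : ℝ} (hr : 0 ≤ r)
    (hG : ∀ x, |G x| ≤ c * powWeight β x) (l : List (Ed d)) (hl : ∀ h ∈ l, ‖h‖ < r) (x : Ed d) :
    |mixedDiff l G x| ≤ c * (1 + (1 + r) ^ β) ^ l.length * powWeight β x := by
  induction l generalizing x with
  | nil => simpa [mixedDiff] using hG x
  | cons h l ih =>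
    have ih' := ih (fun h' hh' => hl h' (List.mem_cons_of_mem _ hh'))
    have hc : 0 ≤ c := by
      have := (abs_nonneg _).trans (hG 0)
      exact nonneg_of_mul_nonneg_left this (powWeight_pos β 0)
    have hh : ‖h‖ ≤ r := (hl h List.mem_cons_self).le
    have hw : powWeight β (x + h) ≤ powWeight β x * (1 + r) ^ β :=
      (powWeight_add_le hβ x h).trans (mul_le_mul_of_nonneg_left
        (powWeight_le_of_norm_le hβ hh) (powWeight_pos _ _).le)
    rw [mixedDiff_cons, List.length_cons]
    set a := c * (1 + (1 + r) ^ β) ^ l.length with ha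
    have ha0 : 0 ≤ a := by positivity
    calc _ ≤ |mixedDiff l G (x + h)| + |mixedDiff l G x| := abs_sub _ _
      _ ≤ a * powWeight β (x + h) + a * powWeight β x := add_le_add (ih' _) (ih' _)
      _ ≤ a * (powWeight β x * (1 + r) ^ β) + a * powWeight β x := by gcongr
      _ = _ := by rw [ha]; ring

theorem commute_and_norm_sub_one_mul_le {A : Type*} [NormedRing A] {T P S : A} {δ : ℝ} {n k : ℕ}
    (hT : Commute T P) (hS : Commute S P) (hTn : ‖(T - 1) * P ^ n‖ ≤ δ)
    (hSn : ‖S * P ^ (n * k)‖ ≤ δ ^ k) :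
    Commute ((T - 1) * S) P ∧ ‖(T - 1) * S * P ^ (n * (k + 1))‖ ≤ δ ^ (k + 1) := by
  refine ⟨(hT.sub_left (Commute.one_left _)).mul_left hS, ?_⟩
  have e : (T - 1) * S * P ^ (n * (k + 1)) = ((T - 1) * P ^ n) * (S * P ^ (n * k)) := by
    rw [mul_add_one, add_comm, pow_add, mul_assoc, mul_assoc, ← mul_assoc S,
      (hS.pow_right n).eq, mul_assoc]
  rw [e, pow_succ']
  exact (norm_mul_le _ _).trans (mul_le_mul hTn hSn (norm_nonneg _) ((norm_nonneg _).trans hTn))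

section
variable {μ : Measure (Ed d)} [IsProbabilityMeasure μ]

theorem abs_mixedDiff_convOp_pow_le {r δ : ℝ} {n : ℕ}
    (hδ : ∀ h : Ed d, ‖h‖ < r → ‖(convOp (Measure.dirac h) - 1) * convOp μ ^ n‖ ≤ δ)
    (l : List (Ed d)) (hl : ∀ h ∈ l, ‖h‖ < r) (F : Ed d →ᵇ ℝ) (x : Ed d) :
    |mixedDiff l ((convOp μ ^ (n * l.length)) F) x| ≤ δ ^ l.length * ‖F‖ := by
  have key : ∀ l : List (Ed d), (∀ h ∈ l, ‖h‖ < r) →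
      ∃ S : (Ed d →ᵇ ℝ) →L[ℝ] (Ed d →ᵇ ℝ), Commute S (convOp μ) ∧
        (∀ G : Ed d →ᵇ ℝ, mixedDiff l G = S G) ∧
        ‖S * convOp μ ^ (n * l.length)‖ ≤ δ ^ l.length := by
    intro l
    induction l with
    | nil =>
      intro _
      exact ⟨1, Commute.one_left _, fun G => rfl, by
        rw [List.length_nil, mul_zero, pow_zero, pow_zero, mul_one]
        exact ContinuousLinearMap.norm_id_le⟩
    | cons h l ih =>
      intro hl
      obtain ⟨S, hS, hSG, hSn⟩ := ih fun h' hh' => hl h' (List.mem_cons_of_mem _ hh')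
      obtain ⟨h1, h2⟩ := commute_and_norm_sub_one_mul_le (A := (Ed d →ᵇ ℝ) →L[ℝ] (Ed d →ᵇ ℝ))
        (commute_convOp (Measure.dirac h) μ) hS (hδ h (hl h List.mem_cons_self)) hSn
      refine ⟨(convOp (Measure.dirac h) - 1) * S, h1, fun G => ?_, h2⟩
      ext x
      rw [mixedDiff_cons, hSG, mul_apply_eq_comp, _root_.sub_apply,
        BoundedContinuousFunction.sub_apply, convOp_dirac_apply]
      rfl
  obtain ⟨S, -, hSG, hSn⟩ := key l hl
  rw [hSG, ← mul_apply_eq_comp]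
  exact (BoundedContinuousFunction.norm_coe_le_norm _ x).trans
    ((ContinuousLinearMap.le_opNorm _ _).trans
      (mul_le_mul_of_nonneg_right hSn (norm_nonneg F)))

theorem powWeight_add_le_split {β : ℝ} (hβ : 0 ≤ β) (x y : Ed d) (N : ℕ) :
    powWeight β (x + y) ≤ (((N : ℝ) + 2) / (N + 1)) ^ β * powWeight β x +
      ((N : ℝ) + 2) ^ β * powWeight β y := by
  unfold powWeight
  have hn := norm_add_le x y
  have h1 : (0 : ℝ) < N + 1 := by positivity
  have h2 : (0 : ℝ) < N + 2 := by positivity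
  have hx := norm_nonneg x
  have hy := norm_nonneg y
  rw [← Real.mul_rpow (by positivity) (by positivity),
    ← Real.mul_rpow (by positivity) (by positivity)]
  rcases le_or_gt ((N + 1) * (1 + ‖y‖)) (1 + ‖x‖) with h | h
  · refine le_add_of_le_of_nonneg (Real.rpow_le_rpow (by positivity) ?_ hβ) (by positivity)
    rw [div_mul_eq_mul_div, le_div_iff₀ h1]
    nlinarith
  · refine le_add_of_nonneg_of_le (by positivity) (Real.rpow_le_rpow (by positivity) ?_ hβ)
    nlinarith

/-- The weight controlling `N` successive applications of `convOp μ`. -/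
def iterWeight (β m : ℝ) (N : ℕ) (x : Ed d) : ℝ :=
  ((N : ℝ) + 1) ^ β * (powWeight β x + N * ((N : ℝ) + 1) ^ β * m)

theorem integral_iterWeight_le {β : ℝ} (hβ : 0 ≤ β) (hi : Integrable (powWeight β) μ) (N : ℕ)
    (x : Ed d) : Integrable (fun y => iterWeight β (∫ z, powWeight β z ∂μ) N (x + y)) μ ∧
      ∫ y, iterWeight β (∫ z, powWeight β z ∂μ) N (x + y) ∂μ
        ≤ iterWeight β (∫ z, powWeight β z ∂μ) (N + 1) x := by
  set m := ∫ z, powWeight β z ∂μ with hm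
  have hm0 : 0 ≤ m := integral_nonneg fun z => (powWeight_pos _ _).le
  have hshift : Integrable (fun y => powWeight β (x + y)) μ := by
    refine (hi.const_mul (powWeight β x)).mono'
      (((continuous_powWeight hβ).comp (by fun_prop)).aestronglyMeasurable)
      (ae_of_all _ fun y => ?_)
    rw [Real.norm_of_nonneg (powWeight_pos _ _).le]
    exact powWeight_add_le hβ x y
  have hint : ∫ y, powWeight β (x + y) ∂μ ≤
      (((N : ℝ) + 2) / (N + 1)) ^ β * powWeight β x + ((N : ℝ) + 2) ^ β * m := by
    calc _ ≤ ∫ y, ((((N : ℝ) + 2) / (N + 1)) ^ β * powWeight β x +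
          ((N : ℝ) + 2) ^ β * powWeight β y) ∂μ :=
          integral_mono hshift ((integrable_const _).add (hi.const_mul _))
            fun y => powWeight_add_le_split hβ x y N
      _ = _ := by
          rw [integral_add (integrable_const _) (hi.const_mul _)]
          simp only [integral_const, probReal_univ, smul_eq_mul, one_mul, integral_const_mul, ← hm]
  have hi2 := (hshift.add (integrable_const (μ := μ) (N * ((N : ℝ) + 1) ^ β * m))).const_mul
    (((N : ℝ) + 1) ^ β)
  refine ⟨hi2, ?_⟩
  unfold iterWeight
  rw [integral_const_mul, integral_add hshift (integrable_const _)]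
  simp only [integral_const, probReal_univ, smul_eq_mul, one_mul]
  have hdiv : ((N : ℝ) + 1) ^ β * (((N : ℝ) + 2) / (N + 1)) ^ β = (N + 2) ^ β := by
    rw [← Real.mul_rpow (by positivity) (by positivity)]
    congr 1
    field_simp
  have hle : ((N : ℝ) + 1) ^ β ≤ (N + 2) ^ β :=
    Real.rpow_le_rpow (by positivity) (by linarith) hβ
  have hp1 : (0 : ℝ) < ((N : ℝ) + 1) ^ β := by positivity
  have hp2 : (0 : ℝ) < ((N : ℝ) + 2) ^ β := by positivity
  push_cast
  rw [show (N : ℝ) + 1 + 1 = N + 2 by ring]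
  calc _ ≤ ((N : ℝ) + 1) ^ β * ((((N : ℝ) + 2) / (N + 1)) ^ β * powWeight β x +
        ((N : ℝ) + 2) ^ β * m + N * ((N : ℝ) + 1) ^ β * m) := by gcongr
    _ = (N + 2) ^ β * powWeight β x + ((N : ℝ) + 1) ^ β * (((N : ℝ) + 2) ^ β * m +
        N * ((N : ℝ) + 1) ^ β * m) := by rw [← hdiv]; ring
    _ ≤ (N + 2) ^ β * powWeight β x + ((N : ℝ) + 2) ^ β * (((N : ℝ) + 2) ^ β * m +
        N * ((N : ℝ) + 2) ^ β * m) := by gcongr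
    _ = _ := by ring

theorem abs_sub_convOp_pow_le {β : ℝ} (hβ : 0 ≤ β) (hi : Integrable (powWeight β) μ)
    {f : Ed d → ℝ} (hfi : ∀ x, Integrable (fun y => f (x + y)) μ)
    (hf : ∀ x, ∫ y, f (x + y) ∂μ = f x) {F : Ed d →ᵇ ℝ} {ε : ℝ}
    (hε : ∀ x, |f x - F x| ≤ ε * powWeight β x) (N : ℕ) (x : Ed d) :
    |f x - (convOp μ ^ N) F x| ≤ ε * iterWeight β (∫ z, powWeight β z ∂μ) N x := by
  induction N generalizing x with
  | zero => simpa [iterWeight] using hε x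
  | succ N ih =>
    have hε0 : 0 ≤ ε :=
      nonneg_of_mul_nonneg_left ((abs_nonneg _).trans (hε 0)) (powWeight_pos β 0)
    obtain ⟨h1, h2⟩ := integral_iterWeight_le hβ hi N x
    rw [pow_succ', mul_apply_eq_comp, convOp_apply, ← hf x,
      ← integral_sub (hfi x) (integrable_comp_add μ _ x)]
    calc _ ≤ ∫ y, |f (x + y) - (convOp μ ^ N) F (x + y)| ∂μ := abs_integral_le_integral_abs
      _ ≤ ∫ y, ε * iterWeight β (∫ z, powWeight β z ∂μ) N (x + y) ∂μ :=
          integral_mono ((hfi x).sub (integrable_comp_add μ _ x)).abs (h1.const_mul ε)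
            fun y => ih _
      _ ≤ _ := by
          rw [integral_const_mul]
          gcongr

theorem iterWeight_le {β m : ℝ} (hβ : 0 ≤ β) (hm : 0 ≤ m) (N : ℕ) (x : Ed d) :
    iterWeight β m N x ≤ ((N : ℝ) + 1) ^ (2 * β + 1) * (1 + m) * powWeight β x := by
  have h1 : (1 : ℝ) ≤ ((N : ℝ) + 1) := by simp
  have h2 : (1 : ℝ) ≤ ((N : ℝ) + 1) ^ β := Real.one_le_rpow h1 hβ
  have hw := one_le_powWeight hβ x
  have e : ((N : ℝ) + 1) ^ (2 * β + 1) =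
      ((N : ℝ) + 1) ^ β * (((N : ℝ) + 1) * ((N : ℝ) + 1) ^ β) := by
    rw [show 2 * β + 1 = β + (1 + β) by ring, Real.rpow_add (by positivity),
      Real.rpow_add (by positivity), Real.rpow_one]
  rw [e, iterWeight]
  set a := ((N : ℝ) + 1) ^ β
  have h3 : powWeight β x ≤ ((N : ℝ) + 1) * a * powWeight β x :=
    le_mul_of_one_le_left (by linarith) (h1.trans (le_mul_of_one_le_right (by linarith) h2))
  have h4 : (N : ℝ) * a * m ≤ ((N : ℝ) + 1) * a * m * powWeight β x := by
    calc (N : ℝ) * a * m ≤ ((N : ℝ) + 1) * a * m := by gcongr; linarith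
      _ ≤ _ := le_mul_of_one_le_right (by positivity) hw
  calc _ ≤ a * (((N : ℝ) + 1) * a * (1 + m) * powWeight β x) :=
        mul_le_mul_of_nonneg_left (by linarith) (by linarith)
    _ = _ := by ring

end

section
variable {β γ : ℝ}

theorem exists_boundedContinuous_approx (hγ : 0 ≤ γ) (hγβ : γ ≤ β) {f : Ed d → ℝ}
    (hf : Continuous f) {C ρ : ℝ} (hC : 0 ≤ C) (hρ : 0 < ρ)
    (hfb : ∀ x, |f x| ≤ C * powWeight γ x) :
    ∃ F : Ed d →ᵇ ℝ, ‖F‖ ≤ C * ρ ^ γ ∧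
      ∀ x, |f x - F x| ≤ C * ρ ^ (γ - β) * powWeight β x := by
  set L := C * ρ ^ γ with hL
  have hL0 : 0 ≤ L := by positivity
  have hb : ∀ x, ‖max (-L) (min L (f x))‖ ≤ L := fun x => by
    rw [Real.norm_eq_abs, abs_le]
    exact ⟨le_max_left _ _, max_le (by linarith) (min_le_left _ _)⟩
  refine ⟨BoundedContinuousFunction.ofNormedAddCommGroup (fun x => max (-L) (min L (f x)))
    (by fun_prop) L hb, BoundedContinuousFunction.norm_ofNormedAddCommGroup_le _ hL0 hb,
    fun x => ?_⟩
  change |f x - max (-L) (min L (f x))| ≤ _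
  have hw := powWeight_pos β x
  rcases le_or_gt |f x| L with h | h
  · rw [min_eq_right (abs_le.1 h).2, max_eq_right (abs_le.1 h).1, sub_self, abs_zero]
    positivity
  · have h1 : |f x - max (-L) (min L (f x))| ≤ |f x| := by
      rcases lt_abs.1 h with h | h
      · rw [min_eq_left h.le, max_eq_right (by linarith), abs_of_nonneg (by linarith),
          abs_of_nonneg (by linarith)]
        linarith
      · rw [min_eq_right (by linarith), max_eq_left (by linarith), abs_of_nonpos (by linarith),
          abs_of_nonpos (by linarith)]
        linarith
    have h2 : ρ < 1 + ‖x‖ := by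
      by_contra! hx
      have : powWeight γ x ≤ ρ ^ γ := Real.rpow_le_rpow (by positivity) hx hγ
      have := (hfb x).trans (mul_le_mul_of_nonneg_left this hC)
      linarith
    have h3 : powWeight γ x ≤ ρ ^ (γ - β) * powWeight β x := by
      have e : powWeight γ x = powWeight (γ - β) x * powWeight β x := by
        rw [powWeight, powWeight, powWeight, ← Real.rpow_add (by positivity)]
        ring_nf
      rw [e]
      exact mul_le_mul_of_nonneg_right
        (Real.rpow_le_rpow_of_nonpos hρ h2.le (by linarith)) hw.le
    calc _ ≤ C * powWeight γ x := h1.trans (hfb x)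
      _ ≤ C * (ρ ^ (γ - β) * powWeight β x) := by gcongr
      _ = _ := by ring

/-- Functions of moderate growth that are invariant under averaging against a probability measure
with a continuous density have vanishing small mixed differences of high order. -/
theorem exists_mixedDiff_eq_zero (hγ : 0 ≤ γ) (hγβ : γ < β) {q : Ed d → ℝ} (hq : Continuous q)
    {μ : Measure (Ed d)} [IsProbabilityMeasure μ]
    (hμ : μ = volume.withDensity fun x => ENNReal.ofReal (q x))
    (hi : Integrable (powWeight β) μ) :
    ∃ r > 0, ∃ k : ℕ, ∀ f : Ed d → ℝ, Continuous f → ∀ C : ℝ,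
      (∀ x, |f x| ≤ C * powWeight γ x) → (∀ x, ∫ y, f (x + y) ∂μ = f x) →
      ∀ l : List (Ed d), l.length = k → (∀ h ∈ l, ‖h‖ < r) → ∀ x, mixedDiff l f x = 0 := by
  obtain ⟨r, hr, m, hm, hbound⟩ := exists_norm_convOp_pow_le hq hμ
  have hβ : 0 ≤ β := hγ.trans hγβ.le
  set σ := (2 * β + 2) / (β - γ) with hσ
  have hσ0 : 0 ≤ σ := div_nonneg (by linarith) (by linarith)
  obtain ⟨k, hk⟩ := exists_nat_gt (2 * (σ * γ))
  refine ⟨r, hr, k, fun f hf C hfb hfh l hlk hl x => ?_⟩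
  have hC : 0 ≤ C := nonneg_of_mul_nonneg_left ((abs_nonneg _).trans (hfb 0)) (powWeight_pos γ 0)
  have hfi : ∀ x, Integrable (fun y => f (x + y)) μ := fun x => by
    refine (hi.const_mul (C * powWeight β x)).mono'
      (Continuous.aestronglyMeasurable (by fun_prop)) (ae_of_all _ fun y => ?_)
    calc _ ≤ C * powWeight γ (x + y) := hfb _
      _ ≤ C * (powWeight β x * powWeight β y) := by
          gcongr
          exact (powWeight_mono hγβ.le _).trans (powWeight_add_le hβ x y)
      _ = _ := by ring
  set A := 1 + (1 + r) ^ β with hA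
  have hA0 : 0 ≤ A := by positivity
  set m' := ∫ z, powWeight β z ∂μ with hm'
  have hm0 : 0 ≤ m' := integral_nonneg fun z => (powWeight_pos _ _).le
  set c₁ := C * (((k : ℝ) + 1) ^ (2 * β + 1) * (1 + m')) * A ^ k * powWeight β x with hc₁
  set c₂ := (2 / √(2 * m)) ^ k * C with hc₂
  have main : ∀ n : ℕ, |mixedDiff l f x| ≤ c₁ * ((n : ℝ) + 1) ^ (-1 : ℝ) +
      c₂ * ((n : ℝ) + 1) ^ (-((k : ℝ) / 2 - σ * γ)) := by
    intro n
    have hn : (0 : ℝ) < (n : ℝ) + 1 := by positivity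
    obtain ⟨F, hFn, hF⟩ := exists_boundedContinuous_approx hγ hγβ.le hf hC
      (Real.rpow_pos_of_pos hn σ) hfb
    set N := n * l.length with hN
    have hNle : (N : ℝ) + 1 ≤ ((k : ℝ) + 1) * ((n : ℝ) + 1) := by
      rw [hN, hlk]
      push_cast
      nlinarith [(Nat.cast_nonneg n : (0 : ℝ) ≤ n), (Nat.cast_nonneg k : (0 : ℝ) ≤ k)]
    have hsplit : f = (fun y => f y - (convOp μ ^ N) F y) + ⇑((convOp μ ^ N) F) := by
      ext y
      simp
    have h1 : ∀ y, |f y - (convOp μ ^ N) F y| ≤ (C * (((k : ℝ) + 1) ^ (2 * β + 1) * (1 + m')) *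
        ((n : ℝ) + 1) ^ (-1 : ℝ)) * powWeight β y := fun y => by
      have hw := (powWeight_pos β y).le
      refine (abs_sub_convOp_pow_le hβ hi hfi hfh hF N y).trans ?_
      have e : (((n : ℝ) + 1) ^ σ) ^ (γ - β) * ((n : ℝ) + 1) ^ (2 * β + 1)
          = ((n : ℝ) + 1) ^ (-1 : ℝ) := by
        rw [← Real.rpow_mul hn.le, ← Real.rpow_add hn]
        congr 1
        have : β - γ ≠ 0 := by linarith
        rw [hσ]
        field_simp
        ring
      have hNp : ((N : ℝ) + 1) ^ (2 * β + 1) ≤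
          ((k : ℝ) + 1) ^ (2 * β + 1) * ((n : ℝ) + 1) ^ (2 * β + 1) := by
        rw [← Real.mul_rpow (by positivity) hn.le]
        exact Real.rpow_le_rpow (by positivity) hNle (by linarith)
      have hV := (iterWeight_le hβ hm0 N y).trans
        (mul_le_mul_of_nonneg_right (mul_le_mul_of_nonneg_right hNp (by linarith)) hw)
      rw [← e]
      refine (mul_le_mul_of_nonneg_left hV (by positivity)).trans_eq ?_
      generalize (((n : ℝ) + 1) ^ σ) ^ (γ - β) = a₁
      generalize ((n : ℝ) + 1) ^ (2 * β + 1) = a₂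
      generalize ((k : ℝ) + 1) ^ (2 * β + 1) = a₃
      ring
    have h2 := abs_mixedDiff_le hβ hr.le h1 l hl x
    have h3 := abs_mixedDiff_convOp_pow_le (fun h hh => hbound h hh n) l hl F x
    rw [hlk] at h2 h3
    rw [hsplit, mixedDiff_add, Pi.add_apply]
    refine (abs_add_le _ _).trans (add_le_add (h2.trans_eq ?_) ?_)
    · rw [hc₁]
      ring
    · rw [← hlk, ← hN] at h3
      refine h3.trans ?_
      rw [hlk]
      have e : (2 / √(2 * m * ((n : ℝ) + 1))) ^ k =
          (2 / √(2 * m)) ^ k * ((n : ℝ) + 1) ^ (-((k : ℝ) / 2)) := by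
        rw [Real.sqrt_mul (by positivity), ← div_div, div_pow, div_eq_mul_inv,
          Real.rpow_neg hn.le, Real.sqrt_eq_rpow ((n : ℝ) + 1), ← Real.rpow_natCast,
          ← Real.rpow_natCast, ← Real.rpow_mul hn.le]
        congr 3
        ring
      calc _ ≤ (2 / √(2 * m * ((n : ℝ) + 1))) ^ k * (C * (((n : ℝ) + 1) ^ σ) ^ γ) := by gcongr
        _ = _ := by
          rw [e, ← Real.rpow_mul hn.le, show -((k : ℝ) / 2 - σ * γ) = -((k : ℝ) / 2) + σ * γ by ring,
            Real.rpow_add hn, hc₂]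
          ring
  have ht : Tendsto (fun n : ℕ => (n : ℝ) + 1) atTop atTop :=
    tendsto_atTop_add_const_right _ 1 tendsto_natCast_atTop_atTop
  have hlim : Tendsto (fun n : ℕ => c₁ * ((n : ℝ) + 1) ^ (-1 : ℝ) +
      c₂ * ((n : ℝ) + 1) ^ (-((k : ℝ) / 2 - σ * γ))) atTop (𝓝 (c₁ * 0 + c₂ * 0)) :=
    (((tendsto_rpow_neg_atTop one_pos).comp ht).const_mul c₁).add
      (((tendsto_rpow_neg_atTop (by linarith)).comp ht).const_mul c₂)
  rw [mul_zero, mul_zero, add_zero] at hlim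
  exact abs_nonpos_iff.1 (ge_of_tendsto' hlim main)

end

theorem eval_mul_left (P : MvPolynomial (Fin d) ℝ) (t : ℝ) (x : Fin d → ℝ) :
    MvPolynomial.eval (fun i => t * x i) P =
      ∑ m ∈ P.support, t ^ (∑ i, m i) * (P.coeff m * ∏ i, x i ^ m i) := by
  rw [MvPolynomial.eval_eq']
  refine Finset.sum_congr rfl fun m _ => ?_
  simp_rw [mul_pow, Finset.prod_mul_distrib, Finset.prod_pow_eq_pow_sum]
  ring

theorem exists_eval_eq_integral (P : MvPolynomial (Fin d) ℝ) :
    ∃ R : MvPolynomial (Fin d) ℝ, ∀ x : Fin d → ℝ,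
      ∫ t in (0 : ℝ)..1, MvPolynomial.eval (fun i => t * x i) P = MvPolynomial.eval x R := by
  refine ⟨∑ m ∈ P.support, MvPolynomial.monomial m (P.coeff m / ((∑ i, m i : ℕ) + 1)),
    fun x => ?_⟩
  simp_rw [eval_mul_left, map_sum]
  rw [intervalIntegral.integral_finsetSum fun m _ =>
    (Continuous.intervalIntegrable (by fun_prop) _ _)]
  refine Finset.sum_congr rfl fun m _ => ?_
  rw [intervalIntegral.integral_mul_const, integral_pow, MvPolynomial.eval_monomial,
    Finsupp.prod_fintype _ _ fun i => pow_zero _]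
  simp
  ring

theorem totalDegree_le_floor {γ : ℝ} (hγ : 0 ≤ γ) {P : MvPolynomial (Fin d) ℝ} {C : ℝ}
    (hP : ∀ x : Ed d, |MvPolynomial.eval (fun i => x i) P| ≤ C * powWeight γ x) :
    P.totalDegree ≤ ⌊γ⌋₊ := by
  by_contra! hn
  set n := P.totalDegree with hn'
  have hγn : γ < n := Nat.lt_of_floor_lt hn
  have hn0 : 0 < n := (Nat.zero_le _).trans_lt hn
  have hne : MvPolynomial.homogeneousComponent n P ≠ 0 := by
    intro h0
    refine lt_irrefl n ((Finset.sup_lt_iff hn0).2 fun m hm => ?_)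
    refine lt_of_le_of_ne (MvPolynomial.le_totalDegree hm) fun hmn => ?_
    have hc := MvPolynomial.coeff_homogeneousComponent (n := n) (φ := P) m
    rw [h0, MvPolynomial.coeff_zero, if_pos (show m.degree = n from hmn)] at hc
    exact MvPolynomial.mem_support_iff.1 hm hc.symm
  refine hne (MvPolynomial.funext fun x => ?_)
  rw [map_zero]
  have hlim : Tendsto (fun t : ℝ => MvPolynomial.eval (fun i => t * x i) P / t ^ n) atTop
      (𝓝 (MvPolynomial.eval x (MvPolynomial.homogeneousComponent n P))) := by
    have e : MvPolynomial.eval x (MvPolynomial.homogeneousComponent n P) = ∑ m ∈ P.support,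
        if (∑ i, m i) = n then (P.coeff m * ∏ i, x i ^ m i) else 0 := by
      rw [MvPolynomial.homogeneousComponent_apply, map_sum, Finset.sum_filter]
      refine Finset.sum_congr rfl fun m _ => ?_
      rw [Finsupp.degree_eq_sum, MvPolynomial.eval_monomial,
        Finsupp.prod_fintype _ _ fun i => pow_zero _]
    rw [e]
    simp_rw [eval_mul_left, Finset.sum_div]
    refine tendsto_finsetSum _ fun m hm => ?_
    have hmn : ∑ i, m i ≤ n := by
      have := MvPolynomial.le_totalDegree hm
      rwa [Finsupp.sum_fintype _ _ fun i => rfl] at this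
    split_ifs with h
    · refine tendsto_const_nhds.congr' ?_
      filter_upwards [eventually_gt_atTop 0] with t ht
      rw [h]
      field_simp
    · have h' : ∑ i, m i < n := lt_of_le_of_ne hmn h
      have := (tendsto_pow_div_pow_atTop_zero (𝕜 := ℝ) h').mul_const (P.coeff m * ∏ i, x i ^ m i)
      rw [zero_mul] at this
      refine this.congr fun t => ?_
      ring
  have hzero : Tendsto (fun t : ℝ => MvPolynomial.eval (fun i => t * x i) P / t ^ n) atTop
      (𝓝 0) := by
    have hC : 0 ≤ C :=
      nonneg_of_mul_nonneg_left ((abs_nonneg _).trans (hP 0)) (powWeight_pos γ 0)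
    set X : Ed d := WithLp.toLp 2 x
    have hb : Tendsto (fun t : ℝ => C * (1 + ‖X‖) ^ γ * t ^ (-((n : ℝ) - γ))) atTop
        (𝓝 (C * (1 + ‖X‖) ^ γ * 0)) :=
      (tendsto_rpow_neg_atTop (by linarith)).const_mul _
    rw [mul_zero] at hb
    refine squeeze_zero_norm' ?_ hb
    filter_upwards [eventually_ge_atTop 1] with t ht
    have ht0 : 0 < t := by linarith
    have h1 := hP (t • X)
    have h2 : powWeight γ (t • X) ≤ (1 + ‖X‖) ^ γ * t ^ γ := by
      rw [powWeight, ← Real.mul_rpow (by positivity) ht0.le, norm_smul, Real.norm_of_nonneg ht0.le]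
      exact Real.rpow_le_rpow (by positivity) (by nlinarith [norm_nonneg X]) hγ
    have h3 : |MvPolynomial.eval (fun i => t * x i) P| ≤ C * ((1 + ‖X‖) ^ γ * t ^ γ) :=
      h1.trans (by gcongr)
    rw [norm_div, norm_pow, Real.norm_eq_abs, Real.norm_of_nonneg ht0.le, div_le_iff₀ (by positivity)]
    refine h3.trans_eq ?_
    rw [mul_assoc, mul_assoc, ← Real.rpow_natCast, ← Real.rpow_add ht0]
    ring_nf
  exact tendsto_nhds_unique hlim hzero

theorem contDiff_mixedDiff_and_fderiv {f : Ed d → ℝ} (hf : ContDiff ℝ (⊤ : ℕ∞) f)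
    (l : List (Ed d)) : ContDiff ℝ (⊤ : ℕ∞) (mixedDiff l f) ∧
      ∀ x v, fderiv ℝ (mixedDiff l f) x v = mixedDiff l (fun z => fderiv ℝ f z v) x := by
  induction l with
  | nil => exact ⟨hf, fun x v => rfl⟩
  | cons h l ih =>
    obtain ⟨h1, h2⟩ := ih
    have h3 : ContDiff ℝ (⊤ : ℕ∞) fun x => mixedDiff l f (x + h) :=
      h1.comp (contDiff_id.add contDiff_const)
    refine ⟨h3.sub h1, fun x v => ?_⟩
    change fderiv ℝ (fun x => mixedDiff l f (x + h) - mixedDiff l f x) x v = _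
    rw [fderiv_fun_sub (h3.differentiable (by simp) x) (h1.differentiable (by simp) x),
      fderiv_comp_add_right, _root_.sub_apply, h2, h2]
    rfl

theorem mixedDiff_fderiv_eq_zero {f : Ed d → ℝ} (hf : ContDiff ℝ (⊤ : ℕ∞) f) {r : ℝ} (hr : 0 < r)
    {k : ℕ} (h0 : ∀ l : List (Ed d), l.length = k + 1 → (∀ h ∈ l, ‖h‖ < r) →
      ∀ x, mixedDiff l f x = 0) (v : Ed d) (l : List (Ed d)) (hl : l.length = k)
    (hlr : ∀ h ∈ l, ‖h‖ < r) (x : Ed d) : mixedDiff l (fun z => fderiv ℝ f z v) x = 0 := by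
  rw [← (contDiff_mixedDiff_and_fderiv hf l).2]
  have : mixedDiff l f =ᶠ[𝓝 x] fun _ => mixedDiff l f x := by
    filter_upwards [ball_mem_nhds x hr] with z hz
    have := h0 ((z - x) :: l) (by simp [hl]) (by
      intro h hh
      rcases List.mem_cons.1 hh with rfl | hh
      · rwa [← dist_eq_norm]
      · exact hlr h hh) x
    rw [mixedDiff_cons, add_sub_cancel] at this
    linarith
  rw [this.fderiv_eq, fderiv_fun_const]
  rfl

theorem sub_eq_integral_fderiv {f : Ed d → ℝ} (hf : ContDiff ℝ (⊤ : ℕ∞) f) (x : Ed d) :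
    f x - f 0 = ∫ t in (0 : ℝ)..1, ∑ i, x i * fderiv ℝ f (t • x) (EuclideanSpace.single i 1) := by
  have hd : ∀ t : ℝ, HasDerivAt (fun t : ℝ => f (t • x))
      (∑ i, x i * fderiv ℝ f (t • x) (EuclideanSpace.single i 1)) t := fun t => by
    have h1 := (hf.differentiable (by simp) (t • x)).hasFDerivAt.comp_hasDerivAt t
      ((hasDerivAt_id t).smul_const x)
    refine h1.congr_deriv ?_
    rw [one_smul]
    generalize fderiv ℝ f (t • x) = L
    conv_lhs => rw [← (EuclideanSpace.basisFun (Fin d) ℝ).sum_repr x]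
    simp
  have hfd : Continuous (fderiv ℝ f) := hf.continuous_fderiv (by simp)
  rw [intervalIntegral.integral_eq_sub_of_hasDerivAt (fun t _ => hd t)
    (Continuous.intervalIntegrable (by fun_prop) _ _)]
  simp

/-- A smooth function all of whose small mixed differences of a given order vanish is a
polynomial. -/
theorem exists_eval_eq_of_mixedDiff_eq_zero {r : ℝ} (hr : 0 < r) (k : ℕ) {f : Ed d → ℝ}
    (hf : ContDiff ℝ (⊤ : ℕ∞) f)
    (h0 : ∀ l : List (Ed d), l.length = k → (∀ h ∈ l, ‖h‖ < r) → ∀ x, mixedDiff l f x = 0) :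
    ∃ P : MvPolynomial (Fin d) ℝ, ∀ x : Ed d, f x = MvPolynomial.eval (fun i => x i) P := by
  induction k generalizing f with
  | zero => exact ⟨0, fun x => by simpa [mixedDiff] using h0 [] rfl (by simp) x⟩
  | succ k ih =>
    have hg : ∀ i : Fin d, ContDiff ℝ (⊤ : ℕ∞)
        fun z => fderiv ℝ f z (EuclideanSpace.single i (1 : ℝ)) := fun i =>
      (hf.fderiv_right (by simp)).clm_apply contDiff_const
    choose P hP using fun i => ih (hg i) (mixedDiff_fderiv_eq_zero hf hr h0 _)
    choose R hR using fun i => exists_eval_eq_integral (P i)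
    refine ⟨MvPolynomial.C (f 0) + ∑ i, MvPolynomial.X i * R i, fun x => ?_⟩
    have h1 := sub_eq_integral_fderiv hf x
    simp_rw [hP] at h1
    rw [intervalIntegral.integral_finsetSum] at h1
    · simp_rw [intervalIntegral.integral_const_mul] at h1
      have h2 : ∀ i, ∫ t in (0 : ℝ)..1, MvPolynomial.eval (fun j => (t • x) j) (P i)
          = MvPolynomial.eval (fun j => x j) (R i) := fun i => hR i fun j => x j
      simp_rw [h2] at h1
      simp only [map_add, MvPolynomial.eval_C, map_sum, map_mul, MvPolynomial.eval_X]
      linarith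
    · refine fun i _ => Continuous.intervalIntegrable (continuous_const.mul ?_) _ _
      refine (MvPolynomial.continuous_eval (P i)).comp ?_
      fun_prop

theorem exists_totalDegree_le_eval_eq_of_tendsto {m : ℕ} {S : Set (Ed d)} {u : Ed d → ℝ}
    {P : ℕ → MvPolynomial (Fin d) ℝ} (hP : ∀ n, (P n).totalDegree ≤ m)
    (h : ∀ x ∈ S, Tendsto (fun n => MvPolynomial.eval (fun i => x i) (P n)) atTop (𝓝 (u x))) :
    ∃ R : MvPolynomial (Fin d) ℝ, R.totalDegree ≤ m ∧
      ∀ x ∈ S, u x = MvPolynomial.eval (fun i => x i) R := by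
  let L : MvPolynomial (Fin d) ℝ →ₗ[ℝ] (S → ℝ) :=
    LinearMap.pi fun x => (MvPolynomial.aeval fun i => x.1 i).toLinearMap
  let V : Submodule ℝ (S → ℝ) := (MvPolynomial.restrictTotalDegree (Fin d) ℝ m).map L
  have hmem : ∀ n, L (P n) ∈ V := fun n =>
    Submodule.mem_map_of_mem ((MvPolynomial.mem_restrictTotalDegree _ _ _).2 (hP n))
  have hL : ∀ R x, L R x = MvPolynomial.eval (fun i => x.1 i) R := fun R x => by
    simp [L]
  have hlim : Tendsto (fun n => L (P n)) atTop (𝓝 fun x : S => u x) :=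
    tendsto_pi_nhds.2 fun x => by simpa only [hL] using h x.1 x.2
  obtain ⟨R, hR, he⟩ := V.closed_of_finiteDimensional.mem_of_tendsto hlim
    (Eventually.of_forall hmem)
  refine ⟨R, (MvPolynomial.mem_restrictTotalDegree _ _ _).1 hR, fun x hx => ?_⟩
  rw [← hL R ⟨x, hx⟩, he]

theorem isMollifier_normed (χ : ContDiffBump (0 : Ed d)) (h : χ.rOut ≤ 1) :
    IsMollifier (χ.normed volume) where
  contDiff := χ.contDiff_normed
  tsupport_subset := by
    rw [χ.tsupport_normed_eq]; exact closedBall_subset_closedBall h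
  nonneg := χ.nonneg_normed
  integral_eq_one := χ.integral_normed

theorem kernelConv_eq_convolution (g k : Ed d → ℝ) :
    kernelConv g k = (k ⋆[ContinuousLinearMap.lsmul ℝ ℝ, volume] g) := by
  ext x
  simp only [kernelConv, convolution_eq_swap, ContinuousLinearMap.lsmul_apply, smul_eq_mul,
    mul_comm]

/-- Mollifications of a weak solution of polynomial growth are polynomials. -/
theorem exists_kernelConv_eq_eval {b : Ed d} {Q : Matrix (Fin d) (Fin d) ℝ} {ν : Measure (Ed d)}
    {u φ : Ed d → ℝ} {β γ M : ℝ} (hT : IsLevyTriplet b Q ν)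
    (hC1 : ∀ t : ℝ, 0 < t → ∃ p : Ed d → ℝ, ContDiff ℝ 1 p ∧
      (∃ K : ℝ, ∀ x, |p x| ≤ K ∧ ‖fderiv ℝ p x‖ ≤ K) ∧ IsTransDensity b Q ν t p)
    (hC2 : IntegrableOn (fun y => ‖y‖ ^ β) {y : Ed d | 1 ≤ ‖y‖} ν)
    (hγ : 0 ≤ γ) (hγβ : γ < β) (hu : Measurable u) (hM : 0 ≤ M)
    (hub : ∀ x, |u x| ≤ M * powWeight γ x) (hul : LocallyIntegrable u)
    (hw : IsWeakSolZero b Q ν u) (h : IsMollifier φ) :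
    ∃ P : MvPolynomial (Fin d) ℝ, P.totalDegree ≤ ⌊γ⌋₊ ∧
      ∀ x : Ed d, kernelConv u φ x = MvPolynomial.eval (fun i => x i) P := by
  have hβ : 0 ≤ β := hγ.trans hγβ.le
  obtain ⟨μ, hμ, hμ0, hμd⟩ := exists_levyFlow hC1
  obtain ⟨τ, hτ, B, hB⟩ := exists_moment_bound hT hC2 hβ hμ hμ0 h
  have := hμ.isProb τ hτ.le
  obtain ⟨q, hq, -, hμq⟩ := hμd τ hτ
  obtain ⟨r, hr, k, hk⟩ := exists_mixedDiff_eq_zero hγ hγβ hq hμq (hB τ ⟨hτ.le, le_rfl⟩).1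
  have hsm : ContDiff ℝ (⊤ : ℕ∞) (kernelConv u φ) := by
    rw [kernelConv_eq_convolution]
    exact h.hasCompactSupport.contDiff_convolution_left _ h.contDiff hul
  have hb : ∀ x, |kernelConv u φ x| ≤ M * 2 ^ γ * powWeight γ x := fun x => by
    refine (((isTemperate_powWeight hγ le_rfl).const_mul hM).abs_kernelConv_le hub
      h.contDiff.continuous.measurable (h.integrable_mul hγ) x).trans ?_
    refine (mul_le_mul_of_nonneg_left (h.integral_abs_mul_le hγ)
      (mul_nonneg hM (powWeight_pos _ _).le)).trans_eq (by ring)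
  obtain ⟨P, hP⟩ := exists_eval_eq_of_mixedDiff_eq_zero hr k hsm
    (hk _ hsm.continuous _ hb (integral_kernelConv_add_eq hT hC2 hγ hγβ hμ hμ0 h hτ hB hu hM hub
      (hw.integral_mul_levyGen h.contDiff h.hasCompactSupport)))
  exact ⟨P, totalDegree_le_floor hγ fun x => hP x ▸ hb x, hP⟩

end

/-- **Liouville theorem for Lévy generators.** If `u` is a weak solution of `Au = 0` of
polynomial growth of order `γ < β`, then `u` is a.e. equal to a polynomial of degree `≤ ⌊γ⌋`. -/
theorem statement0 {d : ℕ} (b : Ed d) (Q : Matrix (Fin d) (Fin d) ℝ) (ν : Measure (Ed d))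
    (hT : IsLevyTriplet b Q ν)
    (hC1 : ∀ t : ℝ, 0 < t → ∃ p : Ed d → ℝ, ContDiff ℝ 1 p ∧
      (∃ K : ℝ, ∀ x, |p x| ≤ K ∧ ‖fderiv ℝ p x‖ ≤ K) ∧ IsTransDensity b Q ν t p)
    (β : ℝ) (hβ : 0 < β)
    (hC2 : IntegrableOn (fun y => ‖y‖ ^ β) {y : Ed d | 1 ≤ ‖y‖} ν)
    (u : Ed d → ℝ) (hu : Measurable u) (M γ : ℝ) (hM : 0 < M) (hγ0 : 0 ≤ γ) (hγβ : γ < β)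
    (hgrowth : ∀ x, |u x| ≤ M * (1 + ‖x‖ ^ γ))
    (hweak : IsWeakSolZero b Q ν u) :
    ∃ P : MvPolynomial (Fin d) ℝ, P.totalDegree ≤ ⌊γ⌋₊ ∧
      ∀ᵐ x ∂(volume : Measure (Ed d)), u x = MvPolynomial.eval (fun i => x i) P := by
  have hub : ∀ x, |u x| ≤ 2 * M * powWeight γ x := fun x => by
    have h1 : 1 ≤ powWeight γ x := one_le_powWeight hγ0 x
    have h2 : ‖x‖ ^ γ ≤ powWeight γ x :=
      rpow_le_rpow (norm_nonneg x) (by linarith) hγ0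
    refine (hgrowth x).trans ?_
    nlinarith
  have hul : LocallyIntegrable u :=
    (continuous_const.mul (continuous_powWeight hγ0)).locallyIntegrable.mono
      hu.aestronglyMeasurable (ae_of_all _ fun x => (hub x).trans (le_abs_self _))
  let χ : ℕ → ContDiffBump (0 : Ed d) := fun n =>
    { rIn := 1 / (n + 1) / 2
      rOut := 1 / (n + 1)
      rIn_pos := by positivity
      rIn_lt_rOut := half_lt_self (by positivity) }
  have hχ : ∀ n, IsMollifier ((χ n).normed volume) := fun n =>
    isMollifier_normed _ (div_le_one_of_le₀ (by simp) (by positivity))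
  choose P hP hPe using fun n =>
    exists_kernelConv_eq_eval hT hC1 hC2 hγ0 hγβ hu (by positivity) hub hul hweak (hχ n)
  have hlim : ∀ᵐ x, Tendsto (fun n => kernelConv u ((χ n).normed volume) x) atTop (𝓝 (u x)) := by
    simp only [kernelConv_eq_convolution]
    exact ContDiffBump.ae_convolution_tendsto_right_of_locallyIntegrable (φ := χ) (K := 2)
      tendsto_one_div_add_atTop_nhds_zero_nat
      (Eventually.of_forall fun n => by simp only [χ]; linarith) hul
  obtain ⟨R, hR, hRe⟩ := exists_totalDegree_le_eval_eq_of_tendsto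
    (S := {x | Tendsto (fun n => kernelConv u ((χ n).normed volume) x) atTop (𝓝 (u x))}) hP
    fun x hx => by simpa only [← hPe, Set.mem_ofPred_eq] using hx
  exact ⟨R, hR, hlim.mono hRe⟩
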